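/- Uniform bounds for the family of solutions in α: under the existence hypotheses (β ≤ A ≤ 1, A ∈ C^{0,1}(ℝ³), φ ∈ L²(𝕋³)), let (u_(α))_{α>0} be the family of weak Leray solutions of the Navier–Stokes-alpha model with regularized nonlinear filter, all with the same data u₀ ∈ L²_s(𝕋³) and f ∈ L²([0,T],Ḣ⁻¹(𝕋³)). Then there is a quantity 0 < M₁ = M₁(u₀,f,ν,T) < ∞, independent of α, such that: (1) sup_{α>0} ‖u_(α)‖_{E_T} ≤ M₁; (2) sup_{α>0} ‖∂_t u_(α)‖_{L²([0,T],H^{−3/2}(𝕋³))} ≤ M₁. Moreover the filtered velocities satisfy sup_{α>0} ‖u_(α),α‖_{L^∞([0,T],L²)} ≤ M₁. -/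

import Mathlib

/-!
Common framework for the Navier–Stokes-alpha model with a nonlinear filter equation,
on the periodic torus `𝕋³ = [0,L]³`.  Function spaces are encoded through Fourier
coefficients on the frequency lattice `(2π/L)ℤ³`.
-/

open MeasureTheory Real Filter Topology

noncomputable section

namespace NSAlpha

/-- spatial points -/
abbrev Pt := Fin 3 → ℝ
/-- values of vector fields -/
abbrev Vec := Fin 3 → ℝ
/-- the frequency lattice indices -/
abbrev Lat := Fin 3 → ℤ

/-- fundamental domain `[0,L]³` of the torus of period `L` -/
def box (L : ℝ) : Set Pt := Set.univ.pi fun _ => Set.Icc (0 : ℝ) L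

/-- `L`-periodicity of a vector field -/
def SpacePeriodic (L : ℝ) (g : Pt → Vec) : Prop :=
  ∀ (x : Pt) (n : Lat), g (fun i => x i + L * (n i : ℝ)) = g x

/-- `L`-periodicity of a scalar function -/
def SpacePeriodicS (L : ℝ) (g : Pt → ℝ) : Prop :=
  ∀ (x : Pt) (n : Lat), g (fun i => x i + L * (n i : ℝ)) = g x

/-- the frequency `2πk/L` -/
def freq (L : ℝ) (k : Lat) (i : Fin 3) : ℝ := (2 * π / L) * (k i : ℝ)

/-- `|2πk/L|²` -/
def freqNormSq (L : ℝ) (k : Lat) : ℝ := ∑ i, freq L k i ^ 2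

/-- the character `e^{-i k·x}` -/
def em (L : ℝ) (k : Lat) (x : Pt) : ℂ :=
  Complex.exp (-Complex.I * ((∑ i, freq L k i * x i : ℝ) : ℂ))

/-- `k`-th Fourier coefficient of a scalar function on the torus -/
def fcS (L : ℝ) (g : Pt → ℝ) (k : Lat) : ℂ :=
  (L ^ 3)⁻¹ • ∫ x in box L, em L k x * (g x : ℂ)

/-- `k`-th Fourier coefficient of a vector field (componentwise) -/
def fc (L : ℝ) (g : Pt → Vec) (k : Lat) (i : Fin 3) : ℂ :=
  fcS L (fun x => g x i) k

/-- squared norm of a complex coefficient vector -/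
def cnormSq (c : Fin 3 → ℂ) : ℝ := ∑ i, Complex.normSq (c i)

/-- squared homogeneous Sobolev norm `‖g‖²_{Ḣ^s}` (via Fourier series) -/
def homSobSq (L s : ℝ) (g : Pt → Vec) : ℝ :=
  L ^ 3 * ∑' k : Lat, freqNormSq L k ^ s * cnormSq (fc L g k)

/-- summability of the `Ḣ^s` Fourier series -/
def homSummable (L s : ℝ) (g : Pt → Vec) : Prop :=
  Summable fun k : Lat => freqNormSq L k ^ s * cnormSq (fc L g k)

/-- squared nonhomogeneous Sobolev norm `‖g‖²_{H^s}` -/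
def sobSq (L s : ℝ) (g : Pt → Vec) : ℝ :=
  L ^ 3 * ∑' k : Lat, (1 + freqNormSq L k) ^ s * cnormSq (fc L g k)

/-- summability of the `H^s` Fourier series -/
def sobSummable (L s : ℝ) (g : Pt → Vec) : Prop :=
  Summable fun k : Lat => (1 + freqNormSq L k) ^ s * cnormSq (fc L g k)

/-- squared homogeneous Sobolev norm of a scalar function -/
def homSobSqS (L s : ℝ) (g : Pt → ℝ) : ℝ :=
  L ^ 3 * ∑' k : Lat, freqNormSq L k ^ s * Complex.normSq (fcS L g k)

/-- zero mean value -/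
def ZeroMean (L : ℝ) (g : Pt → Vec) : Prop := ∀ i, fc L g 0 i = 0

/-- divergence-free condition, in the Fourier (distributional) sense -/
def DivFree (L : ℝ) (g : Pt → Vec) : Prop :=
  ∀ k : Lat, ∑ i, (freq L k i : ℂ) * fc L g k i = 0

/-- membership in `L²_s(𝕋³)` : periodic, integrable, zero-mean, divergence-free,
with square-summable Fourier coefficients -/
def MemL2s (L : ℝ) (g : Pt → Vec) : Prop :=
  SpacePeriodic L g ∧ IntegrableOn g (box L) ∧ ZeroMean L g ∧ DivFree L g ∧
    homSummable L 0 g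

/-- membership in the (zero-mean) Sobolev space `H^s(𝕋³)` -/
def MemHs (L s : ℝ) (g : Pt → Vec) : Prop :=
  SpacePeriodic L g ∧ IntegrableOn g (box L) ∧ ZeroMean L g ∧ sobSummable L s g

/-- periodic convolution `φ ∗ g` on the torus -/
def pconv (L : ℝ) (φ : Pt → ℝ) (g : Pt → Vec) (x : Pt) : Vec :=
  fun i => ∫ y in box L, φ y * g (fun a => x a - y a) i

/-- the Fourier transform of `−α² div(B (∇⊗v)ᵀ) + v`, tested against `e^{-ik·x}eᵢ`
(normalized by `L³`); the derivative of `v` is taken in the weak (Fourier) sense. -/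
def filterLHS (L α : ℝ) (B : Pt → ℝ) (v : Pt → Vec) (k : Lat) (i : Fin 3) : ℂ :=
  ((α ^ 2 : ℝ) : ℂ) *
      ∑' m : Lat, ((∑ a, freq L k a * freq L m a : ℝ) : ℂ) *
        fcS L B (fun a => k a - m a) * fc L v m i
    + fc L v k i

/-- weak formulation of the nonlinear filter equation `−α² div(B (∇⊗v)ᵀ) + v = g` -/
def FilterEq (L α : ℝ) (B : Pt → ℝ) (v g : Pt → Vec) : Prop :=
  ∀ (k : Lat) (i : Fin 3), filterLHS L α B v k i = fc L g k i

/-- Fourier coefficients of the transport term `(v·∇)g = div(g ⊗ v)` (when `div v = 0`) -/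
def transportCoef (L : ℝ) (g v : Pt → Vec) (k : Lat) (i : Fin 3) : ℂ :=
  Complex.I * ∑ j, ((freq L k j : ℝ) : ℂ) * fcS L (fun x => g x i * v x j) k

/-- the Leray projector on Fourier coefficients -/
def leray (L : ℝ) (k : Lat) (c : Fin 3 → ℂ) (i : Fin 3) : ℂ :=
  if k = 0 then c i
  else c i - ((∑ j, c j * ((freq L k j : ℝ) : ℂ)) / ((freqNormSq L k : ℝ) : ℂ)) *
    ((freq L k i : ℝ) : ℂ)

/-- squared `Ḣ⁻¹` norm of a family of Fourier coefficients -/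
def hNegSobSq (L : ℝ) (c : Lat → Fin 3 → ℂ) : ℝ :=
  L ^ 3 * ∑' k : Lat, freqNormSq L k ^ (-(1 : ℝ)) * cnormSq (c k)

/-- an external force in `L²_loc([0,∞), Ḣ⁻¹(𝕋³))`, divergence-free and zero-mean,
represented through its (time-dependent) Fourier coefficients -/
structure ForceData (L : ℝ) where
  coef : ℝ → Lat → Fin 3 → ℂ
  reality : ∀ t k i, coef t (fun j => -k j) i = starRingEnd ℂ (coef t k i)
  zeroMean : ∀ t i, coef t 0 i = 0
  divFree : ∀ t k, ∑ i, (freq L k i : ℂ) * coef t k i = 0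
  hsummable : ∀ t, Summable fun k : Lat => freqNormSq L k ^ (-(1 : ℝ)) * cnormSq (coef t k)
  locL2 : ∀ T : ℝ, 0 < T → IntegrableOn (fun t => hNegSobSq L (coef t)) (Set.Icc 0 T)

/-- a stationary (time-independent) force in `Ḣ⁻¹(𝕋³) ∩ L²_s(𝕋³)` -/
structure StatForce (L : ℝ) where
  coef : Lat → Fin 3 → ℂ
  reality : ∀ k i, coef (fun j => -k j) i = starRingEnd ℂ (coef k i)
  zeroMean : ∀ i, coef 0 i = 0
  divFree : ∀ k, ∑ i, (freq L k i : ℂ) * coef k i = 0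
  memHneg : Summable fun k : Lat => freqNormSq L k ^ (-(1 : ℝ)) * cnormSq (coef k)
  memL2 : Summable fun k : Lat => cnormSq (coef k)

/-- the duality pairing `⟨f, g⟩_{Ḣ⁻¹×Ḣ¹}` -/
def pairing (L : ℝ) (c : Lat → Fin 3 → ℂ) (g : Pt → Vec) : ℝ :=
  L ^ 3 * (∑' k : Lat, ∑ i, c k i * starRingEnd ℂ (fc L g k i)).re

/-- the `L²` inner product of two fields (by Parseval) -/
def l2Pair (L : ℝ) (g h : Pt → Vec) : ℝ :=
  L ^ 3 * (∑' k : Lat, ∑ i, fc L g k i * starRingEnd ℂ (fc L h k i)).re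

/-- weak formulation of the momentum equation with pressure,
`∂ₜu − νΔu + (v·∇)u + ∇P = f`, `u(0,·)=u₀`, tested in Fourier in space
and against smooth compactly supported functions of time -/
def WeakMomentum (L ν : ℝ) (fcoef : ℝ → Lat → Fin 3 → ℂ) (u v : ℝ → Pt → Vec)
    (P : ℝ → Pt → ℝ) (u₀ : Pt → Vec) : Prop :=
  ∀ (k : Lat) (i : Fin 3) (θ : ℝ → ℝ), ContDiff ℝ (⊤ : ℕ∞) θ → HasCompactSupport θ →
    (∫ t in Set.Ioi (0 : ℝ),
        ((-(deriv θ t) : ℝ) : ℂ) * fc L (u t) k i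
          + ((θ t : ℝ) : ℂ) * (((ν * freqNormSq L k : ℝ) : ℂ) * fc L (u t) k i
              + transportCoef L (u t) (v t) k i
              + Complex.I * ((freq L k i : ℝ) : ℂ) * fcS L (P t) k
              - fcoef t k i))
      = ((θ 0 : ℝ) : ℂ) * fc L u₀ k i

/-- weak formulation of the Leray-projected momentum equation,
`∂ₜu − νΔu + ℙ((v·∇)u) = f`, `u(0,·)=u₀` -/
def WeakMomentumProj (L ν : ℝ) (fcoef : ℝ → Lat → Fin 3 → ℂ) (u v : ℝ → Pt → Vec)
    (u₀ : Pt → Vec) : Prop :=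
  ∀ (k : Lat) (i : Fin 3) (θ : ℝ → ℝ), ContDiff ℝ (⊤ : ℕ∞) θ → HasCompactSupport θ →
    (∫ t in Set.Ioi (0 : ℝ),
        ((-(deriv θ t) : ℝ) : ℂ) * fc L (u t) k i
          + ((θ t : ℝ) : ℂ) * (((ν * freqNormSq L k : ℝ) : ℂ) * fc L (u t) k i
              + leray L k (transportCoef L (u t) (v t) k) i
              - fcoef t k i))
      = ((θ 0 : ℝ) : ℂ) * fc L u₀ k i

/-- weak formulation of the Leray-projected momentum equation on the whole line `ℝ`
(for eternal solutions), with a stationary force -/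
def WeakMomentumProjEternal (L ν : ℝ) (fcoef : Lat → Fin 3 → ℂ) (u v : ℝ → Pt → Vec) :
    Prop :=
  ∀ (k : Lat) (i : Fin 3) (θ : ℝ → ℝ), ContDiff ℝ (⊤ : ℕ∞) θ → HasCompactSupport θ →
    (∫ t : ℝ,
        ((-(deriv θ t) : ℝ) : ℂ) * fc L (u t) k i
          + ((θ t : ℝ) : ℂ) * (((ν * freqNormSq L k : ℝ) : ℂ) * fc L (u t) k i
              + leray L k (transportCoef L (u t) (v t) k) i
              - fcoef k i))
      = 0

/-- the Leray energy inequality -/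
def EnergyIneq (L ν : ℝ) (fcoef : ℝ → Lat → Fin 3 → ℂ) (u : ℝ → Pt → Vec)
    (u₀ : Pt → Vec) : Prop :=
  ∀ t : ℝ, 0 ≤ t →
    homSobSq L 0 (u t) + 2 * ν * ∫ s in Set.Ioc (0 : ℝ) t, homSobSq L 1 (u s)
      ≤ homSobSq L 0 u₀ + 2 * ∫ s in Set.Ioc (0 : ℝ) t, pairing L (fcoef s) (u s)

/-- weak Leray solution of the Navier–Stokes-alpha system with a general
filter coefficient map `Bmap` (the filter coefficient may depend on `u`) -/
structure IsLeraySolGen (L ν α : ℝ) (Bmap : (Pt → Vec) → Pt → ℝ) (u₀ : Pt → Vec)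
    (f : ForceData L) (u uα : ℝ → Pt → Vec) (P : ℝ → Pt → ℝ) : Prop where
  uMem : ∀ t : ℝ, 0 ≤ t → MemL2s L (u t)
  uLocBdd : ∀ T : ℝ, 0 < T → ∃ M : ℝ, ∀ t ∈ Set.Icc (0 : ℝ) T, homSobSq L 0 (u t) ≤ M
  uH1ae : ∀ T : ℝ, 0 < T →
    ∀ᵐ t ∂(volume.restrict (Set.Icc (0 : ℝ) T)), homSummable L 1 (u t)
  uH1int : ∀ T : ℝ, 0 < T → IntegrableOn (fun t => homSobSq L 1 (u t)) (Set.Icc (0 : ℝ) T)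
  uaMem : ∀ t : ℝ, 0 ≤ t → MemHs L 1 (uα t) ∧ DivFree L (uα t)
  uaLocBdd : ∀ T : ℝ, 0 < T → ∃ M : ℝ, ∀ t ∈ Set.Icc (0 : ℝ) T, sobSq L 1 (uα t) ≤ M
  pPeriodic : ∀ t : ℝ, 0 ≤ t → SpacePeriodicS L (P t)
  pL2 : ∀ t : ℝ, 0 ≤ t → IntegrableOn (fun x => P t x ^ 2) (box L)
  pLoc : ∀ T : ℝ, 0 < T →
    IntegrableOn (fun t => ∫ x in box L, P t x ^ 2) (Set.Icc (0 : ℝ) T)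
  momentum : WeakMomentum L ν f.coef u uα P u₀
  filter : ∀ t : ℝ, 0 ≤ t → FilterEq L α (Bmap (u t)) (uα t) (u t)
  energy : EnergyIneq L ν f.coef u u₀

/-- weak Leray solution of the Navier–Stokes-alpha model with the
regularized nonlinear filter `−α² div(A(φ∗u)(∇⊗u_α)ᵀ) + u_α = u` -/
def IsLeraySol (L ν α : ℝ) (A : Vec → ℝ) (φ : Pt → ℝ) (u₀ : Pt → Vec) (f : ForceData L)
    (u uα : ℝ → Pt → Vec) (P : ℝ → Pt → ℝ) : Prop :=
  IsLeraySolGen L ν α (fun g x => A (pconv L φ g x)) u₀ f u uα P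

/-- weak Leray solution of the Leray-projected system with stationary force,
with a general filter coefficient map -/
structure IsLeraySolProjGen (L ν α : ℝ) (Bmap : (Pt → Vec) → Pt → ℝ) (u₀ : Pt → Vec)
    (f : StatForce L) (u uα : ℝ → Pt → Vec) : Prop where
  uMem : ∀ t : ℝ, 0 ≤ t → MemL2s L (u t)
  uLocBdd : ∀ T : ℝ, 0 < T → ∃ M : ℝ, ∀ t ∈ Set.Icc (0 : ℝ) T, homSobSq L 0 (u t) ≤ M
  uH1ae : ∀ T : ℝ, 0 < T →
    ∀ᵐ t ∂(volume.restrict (Set.Icc (0 : ℝ) T)), homSummable L 1 (u t)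
  uH1int : ∀ T : ℝ, 0 < T → IntegrableOn (fun t => homSobSq L 1 (u t)) (Set.Icc (0 : ℝ) T)
  uaMem : ∀ t : ℝ, 0 ≤ t → MemHs L 1 (uα t) ∧ DivFree L (uα t)
  momentum : WeakMomentumProj L ν (fun _ => f.coef) u uα u₀
  filter : ∀ t : ℝ, 0 ≤ t → FilterEq L α (Bmap (u t)) (uα t) (u t)
  energy : EnergyIneq L ν (fun _ => f.coef) u u₀

/-- weak Leray solution of the projected Navier–Stokes-alpha model (regularized filter) -/
def IsLeraySolProj (L ν α : ℝ) (A : Vec → ℝ) (φ : Pt → ℝ) (u₀ : Pt → Vec)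
    (f : StatForce L) (u uα : ℝ → Pt → Vec) : Prop :=
  IsLeraySolProjGen L ν α (fun g x => A (pconv L φ g x)) u₀ f u uα

/-- `S` realizes the solution semi-group of the projected Navier–Stokes-alpha model -/
def IsSolutionSemigroup (L ν α : ℝ) (A : Vec → ℝ) (φ : Pt → ℝ) (f : StatForce L)
    (S : ℝ → (Pt → Vec) → Pt → Vec) : Prop :=
  (∀ g : Pt → Vec, MemL2s L g →
      S 0 g = g ∧ ∃ uα, IsLeraySolProj L ν α A φ g f (fun t => S t g) uα) ∧
    ∀ g : Pt → Vec, MemL2s L g → ∀ s t : ℝ, 0 ≤ s → 0 ≤ t → S (t + s) g = S t (S s g)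

/-- the `L²(𝕋³)` distance between two fields -/
def dL2 (L : ℝ) (g h : Pt → Vec) : ℝ :=
  Real.sqrt (homSobSq L 0 fun x i => g x i - h x i)

/-- bounded subsets of `L²_s(𝕋³)` -/
def IsBoundedL2s (L : ℝ) (B : Set (Pt → Vec)) : Prop :=
  (∀ g ∈ B, MemL2s L g) ∧ ∃ R : ℝ, ∀ g ∈ B, homSobSq L 0 g ≤ R

/-- (sequential) compactness in the strong topology of `L²(𝕋³)` -/
def IsCompactL2 (L : ℝ) (K : Set (Pt → Vec)) : Prop :=
  ∀ seq : ℕ → Pt → Vec, (∀ n, seq n ∈ K) →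
    ∃ g ∈ K, ∃ ψ : ℕ → ℕ, StrictMono ψ ∧
      Tendsto (fun n => dL2 L (seq (ψ n)) g) atTop (nhds 0)

/-- global attractor of the semi-group `S` acting on `L²_s(𝕋³)` : compact,
strictly invariant, and attracting all bounded sets -/
def IsGlobalAttractor (L : ℝ) (S : ℝ → (Pt → Vec) → Pt → Vec)
    (𝒜 : Set (Pt → Vec)) : Prop :=
  (∀ g ∈ 𝒜, MemL2s L g) ∧ IsCompactL2 L 𝒜 ∧
    (∀ t : ℝ, 0 ≤ t → S t '' 𝒜 = 𝒜) ∧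
    ∀ B : Set (Pt → Vec), IsBoundedL2s L B → ∀ ε : ℝ, 0 < ε →
      ∃ T : ℝ, 0 < T ∧ ∀ t : ℝ, T < t → ∀ g ∈ B, ∃ a ∈ 𝒜, dL2 L (S t g) a < ε

/-- eternal solution (defined for all `t ∈ ℝ`) of the projected system -/
structure IsEternalSolGen (L ν α : ℝ) (Bmap : (Pt → Vec) → Pt → ℝ) (f : StatForce L)
    (u uα : ℝ → Pt → Vec) : Prop where
  uMem : ∀ t : ℝ, MemL2s L (u t)
  uLocBdd : ∀ T : ℝ, 0 < T → ∃ M : ℝ, ∀ t ∈ Set.Icc (-T) T, homSobSq L 0 (u t) ≤ M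
  uH1int : ∀ T : ℝ, 0 < T → IntegrableOn (fun t => homSobSq L 1 (u t)) (Set.Icc (-T) T)
  uaMem : ∀ t : ℝ, MemHs L 1 (uα t) ∧ DivFree L (uα t)
  momentum : WeakMomentumProjEternal L ν f.coef u uα
  filter : ∀ t : ℝ, FilterEq L α (Bmap (u t)) (uα t) (u t)

/-- eternal solution of the projected Navier–Stokes-alpha model (regularized filter) -/
def IsEternalSol (L ν α : ℝ) (A : Vec → ℝ) (φ : Pt → ℝ) (f : StatForce L)
    (u uα : ℝ → Pt → Vec) : Prop :=
  IsEternalSolGen L ν α (fun g x => A (pconv L φ g x)) f u uα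

/-- bounded eternal solution -/
def IsBoundedEternalSol (L ν α : ℝ) (A : Vec → ℝ) (φ : Pt → ℝ) (f : StatForce L)
    (u uα : ℝ → Pt → Vec) : Prop :=
  IsEternalSol L ν α A φ f u uα ∧ ∃ M : ℝ, ∀ t : ℝ, homSobSq L 0 (u t) ≤ M

/-- the pointwise bounds `β ≤ A ≤ 1` on the indicator function -/
def IndicatorBounds (β : ℝ) (A : Vec → ℝ) : Prop := ∀ x : Vec, β ≤ A x ∧ A x ≤ 1

/-- `A ∈ C^{0,1}(ℝ³)` (Lipschitz continuity) -/
def IndicatorC01 (A : Vec → ℝ) : Prop := ∃ C : ℝ, ∀ x y : Vec, |A x - A y| ≤ C * ‖x - y‖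

/-- `A ∈ C^{1,1}(ℝ³)` (continuously differentiable with bounded, Lipschitz derivative) -/
def IndicatorC11 (A : Vec → ℝ) : Prop :=
  ContDiff ℝ 1 A ∧ (∃ M : ℝ, ∀ x : Vec, ‖fderiv ℝ A x‖ ≤ M) ∧
    ∃ C : ℝ, ∀ x y : Vec, ‖fderiv ℝ A x - fderiv ℝ A y‖ ≤ C * ‖x - y‖

/-- `φ ∈ L²(𝕋³)` -/
def KernelL2 (L : ℝ) (φ : Pt → ℝ) : Prop :=
  SpacePeriodicS L φ ∧ IntegrableOn φ (box L) ∧ IntegrableOn (fun x => φ x ^ 2) (box L)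

/-- `‖φ‖_{L²(𝕋³)}` -/
def kernelL2Norm (L : ℝ) (φ : Pt → ℝ) : ℝ := Real.sqrt (∫ x in box L, φ x ^ 2)

/-- `‖φ‖²_{H¹(𝕋³)}` -/
def kernelH1Sq (L : ℝ) (φ : Pt → ℝ) : ℝ :=
  L ^ 3 * ∑' k : Lat, (1 + freqNormSq L k) * Complex.normSq (fcS L φ k)

/-- `φ ∈ H¹(𝕋³)` -/
def KernelH1 (L : ℝ) (φ : Pt → ℝ) : Prop :=
  KernelL2 L φ ∧ Summable fun k : Lat => (1 + freqNormSq L k) * Complex.normSq (fcS L φ k)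

/-- `‖φ‖_{H¹(𝕋³)}` -/
def kernelH1Norm (L : ℝ) (φ : Pt → ℝ) : ℝ := Real.sqrt (kernelH1Sq L φ)

/-- `‖∇A‖_{L^∞}` -/
def gradSup (A : Vec → ℝ) : ℝ := ⨆ x : Vec, ‖fderiv ℝ A x‖

/-- `sup_{0≤t≤T} ‖u(t)‖_{L²}` -/
def supNormL2 (L T : ℝ) (u : ℝ → Pt → Vec) : ℝ :=
  ⨆ t : Set.Icc (0 : ℝ) T, Real.sqrt (homSobSq L 0 (u ↑t))

/-- `sup_{0≤t≤T} ‖u(t)‖_{H¹}` -/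
def supNormH1 (L T : ℝ) (u : ℝ → Pt → Vec) : ℝ :=
  ⨆ t : Set.Icc (0 : ℝ) T, Real.sqrt (sobSq L 1 (u ↑t))

/-- the energy norm `‖u‖_{E_T}` -/
def eTNorm (L ν T : ℝ) (u : ℝ → Pt → Vec) : ℝ :=
  supNormL2 L T u + Real.sqrt (ν * ∫ t in Set.Ioc (0 : ℝ) T, homSobSq L 1 (u t))

/-- the constant `K₀ ≃ 1/min(α²β,1)` of the `H¹` filter estimate -/
def K0c (α β : ℝ) : ℝ := 1 / min (α ^ 2 * β) 1

/-- `L₁ = α² C_A ‖φ‖_{L²}` -/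
def L1c (L α CA : ℝ) (φ : Pt → ℝ) : ℝ := α ^ 2 * CA * kernelL2Norm L φ

/-- `L₂ = α² ‖∇A‖_{L^∞} ‖φ‖_{H¹}` -/
def L2c (L α : ℝ) (A : Vec → ℝ) (φ : Pt → ℝ) : ℝ := α ^ 2 * gradSup A * kernelH1Norm L φ

/-- `L₃ = α² ‖φ‖_{H¹} max(C′_A ‖φ‖_{H¹}, ‖∇A‖_{L^∞})` -/
def L3c (L α CA' : ℝ) (A : Vec → ℝ) (φ : Pt → ℝ) : ℝ :=
  α ^ 2 * kernelH1Norm L φ * max (CA' * kernelH1Norm L φ) (gradSup A)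

/-- `K₁ = max(K₀^{3/2} L₁, K₀)` -/
def K1c (L α β CA : ℝ) (φ : Pt → ℝ) : ℝ :=
  max (K0c α β ^ ((3 : ℝ) / 2) * L1c L α CA φ) (K0c α β)

/-- `K₂ = max(K₀^{3/2} L₂, K₀)` -/
def K2c (L α β : ℝ) (A : Vec → ℝ) (φ : Pt → ℝ) : ℝ :=
  max (K0c α β ^ ((3 : ℝ) / 2) * L2c L α A φ) (K0c α β)

/-- `K₃ = max(K₀K₂L₁, K₀K₁L₂, K₀^{3/2}L₃)` -/
def K3c (L α β CA CA' : ℝ) (A : Vec → ℝ) (φ : Pt → ℝ) : ℝ :=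
  max (max (K0c α β * K2c L α β A φ * L1c L α CA φ)
      (K0c α β * K1c L α β CA φ * L2c L α A φ))
    (K0c α β ^ ((3 : ℝ) / 2) * L3c L α CA' A φ)

/-- the quantity `K(α,β)` -/
def Kab (α β : ℝ) : ℝ :=
  if α ≤ 1 then 1 / (α ^ 5 * β ^ ((5 : ℝ) / 2))
  else if α ≤ 1 / Real.sqrt β then 1 / (α * β ^ ((5 : ℝ) / 2))
  else α ^ 4

/-- minimal number of `ε`-balls of `L²(𝕋³)` needed to cover `K` -/
def coveringNumber (L ε : ℝ) (K : Set (Pt → Vec)) : ℕ :=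
  sInf {n : ℕ | ∃ c : Fin n → Pt → Vec, ∀ g ∈ K, ∃ i, dL2 L g (c i) < ε}

/-- the fractal dimension `dim_f(K) = limsup_{ε→0⁺} N_ε(K)/ln(1/ε)` -/
def fractalDim (L : ℝ) (K : Set (Pt → Vec)) : ℝ :=
  Filter.limsup (fun ε : ℝ => (coveringNumber L ε K : ℝ) / Real.log (1 / ε))
    (nhdsWithin 0 (Set.Ioi 0))

/-- squared `L²` norm of the spectral projection `P_m` onto frequencies `|k| ≤ m` -/
def projNormSq (L : ℝ) (m : ℕ) (g : Pt → Vec) : ℝ :=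
  L ^ 3 * ∑' k : Lat,
    (if freqNormSq L k ≤ (m : ℝ) ^ 2 then (1 : ℝ) else 0) * cnormSq (fc L g k)

/-- test data for the weak-* topology of `L^∞(I, L²)` (elements of `L¹(I, L²)`) -/
def TestL1L2 (L : ℝ) (I : Set ℝ) (g : ℝ → Pt → Vec) : Prop :=
  (∀ t ∈ I, SpacePeriodic L (g t) ∧ IntegrableOn (g t) (box L) ∧ homSummable L 0 (g t)) ∧
    IntegrableOn (fun t => Real.sqrt (homSobSq L 0 (g t))) I

/-- test data for the weak topology of `L²(I, Ḣ¹)` (elements of `L²(I, Ḣ⁻¹)`),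
given as Fourier coefficients -/
def TestL2Hneg (L : ℝ) (I : Set ℝ) (c : ℝ → Lat → Fin 3 → ℂ) : Prop :=
  (∀ t ∈ I, Summable fun k : Lat => freqNormSq L k ^ (-(1 : ℝ)) * cnormSq (c t k)) ∧
    IntegrableOn (fun t => hNegSobSq L (c t)) I

/-- convergence in the weak-* topology of `E_T = L^∞([0,T],L²) ∩ L²([0,T],Ḣ¹)` -/
def WeakStarET (L T : ℝ) (un : ℕ → ℝ → Pt → Vec) (u : ℝ → Pt → Vec) : Prop :=
  (∀ g : ℝ → Pt → Vec, TestL1L2 L (Set.Ioc 0 T) g →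
    Tendsto (fun n => ∫ t in Set.Ioc (0 : ℝ) T, l2Pair L (un n t) (g t)) atTop
      (nhds (∫ t in Set.Ioc (0 : ℝ) T, l2Pair L (u t) (g t)))) ∧
  ∀ c : ℝ → Lat → Fin 3 → ℂ, TestL2Hneg L (Set.Ioc 0 T) c →
    Tendsto (fun n => ∫ t in Set.Ioc (0 : ℝ) T, pairing L (c t) (un n t)) atTop
      (nhds (∫ t in Set.Ioc (0 : ℝ) T, pairing L (c t) (u t)))

/-- scalar duality pairing `⟨c, g⟩` (with `c` given by Fourier coefficients) -/
def sPairCoef (L : ℝ) (c : Lat → ℂ) (g : Pt → ℝ) : ℝ :=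
  L ^ 3 * (∑' k : Lat, c k * starRingEnd ℂ (fcS L g k)).re

/-- scalar test data in `L²(I, Ḣ^{1/2})`, for the weak topology of `L²(I, Ḣ^{-1/2})` -/
def TestL2HhalfS (L : ℝ) (I : Set ℝ) (c : ℝ → Lat → ℂ) : Prop :=
  (∀ t ∈ I, Summable fun k : Lat => freqNormSq L k ^ ((1 : ℝ) / 2) * Complex.normSq (c t k)) ∧
    IntegrableOn
      (fun t => L ^ 3 * ∑' k : Lat, freqNormSq L k ^ ((1 : ℝ) / 2) * Complex.normSq (c t k)) I

/-- weak Leray solution of the classical Navier–Stokes equations,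
with pressure in `L²_loc Ḣ^{-1/2}` -/
structure IsLeraySolNSE (L ν : ℝ) (u₀ : Pt → Vec) (f : ForceData L)
    (u : ℝ → Pt → Vec) (P : ℝ → Pt → ℝ) : Prop where
  uMem : ∀ t : ℝ, 0 ≤ t → MemL2s L (u t)
  uLocBdd : ∀ T : ℝ, 0 < T → ∃ M : ℝ, ∀ t ∈ Set.Icc (0 : ℝ) T, homSobSq L 0 (u t) ≤ M
  uH1ae : ∀ T : ℝ, 0 < T →
    ∀ᵐ t ∂(volume.restrict (Set.Icc (0 : ℝ) T)), homSummable L 1 (u t)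
  uH1int : ∀ T : ℝ, 0 < T → IntegrableOn (fun t => homSobSq L 1 (u t)) (Set.Icc (0 : ℝ) T)
  pPeriodic : ∀ t : ℝ, 0 ≤ t → SpacePeriodicS L (P t)
  pIntegrable : ∀ t : ℝ, 0 ≤ t → IntegrableOn (P t) (box L)
  pLoc : ∀ T : ℝ, 0 < T →
    IntegrableOn (fun t => homSobSqS L (-(1 : ℝ) / 2) (P t)) (Set.Icc (0 : ℝ) T)
  momentum : WeakMomentum L ν f.coef u u P u₀
  energy : EnergyIneq L ν f.coef u u₀

/-- an approximation of the identity `(φ_n)` on the torus -/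
def IsApproxIdentity (L : ℝ) (φn : ℕ → Pt → ℝ) : Prop :=
  (∀ n, KernelL2 L (φn n) ∧ (∫ x in box L, φn n x) = 1) ∧
    ∀ g : Pt → Vec, SpacePeriodic L g → IntegrableOn g (box L) → homSummable L 0 g →
      Tendsto (fun n => homSobSq L 0 fun x i => pconv L (φn n) g x i - g x i)
        atTop (nhds 0)


/-- normalized Lebesgue measure on the box -/
def bm (L : ℝ) : Measure Pt := ENNReal.ofReal ((L ^ 3)⁻¹) • volume.restrict (box L)

lemma em_cont (L : ℝ) (k : Lat) : Continuous (em L k) := by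
  unfold em; fun_prop

lemma em_norm (L : ℝ) (k : Lat) (x : Pt) : ‖em L k x‖ = 1 := by
  unfold em
  rw [Complex.norm_exp]
  simp

lemma em_add (L : ℝ) (k m : Lat) (x : Pt) : em L (k + m) x = em L k x * em L m x := by
  unfold em
  rw [← Complex.exp_add]
  congr 1
  simp only [freq, Pi.add_apply]
  push_cast
  simp only [Fin.sum_univ_three]
  ring

lemma em_zero (L : ℝ) (x : Pt) : em L 0 x = 1 := by
  simp [em, freq]

lemma em_neg (L : ℝ) (k : Lat) (x : Pt) : em L (-k) x = starRingEnd ℂ (em L k x) := by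
  unfold em
  rw [← Complex.exp_conj]
  congr 1
  rw [map_mul, map_neg, Complex.conj_I, Complex.conj_ofReal]
  simp [freq]

lemma fcS_eq {L : ℝ} (hL : 0 < L) (g : Pt → ℝ) (k : Lat) :
    fcS L g k = ∫ x, em L k x * (g x : ℂ) ∂(bm L) := by
  rw [bm, integral_smul_measure, ENNReal.toReal_ofReal (by positivity)]
  rfl

lemma integrable_bm {L : ℝ} {E : Type*} [NormedAddCommGroup E] {g : Pt → E}
    (h : IntegrableOn g (box L)) : Integrable g (bm L) :=
  h.smul_measure ENNReal.ofReal_ne_top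

lemma box_vol {L : ℝ} (hL : 0 < L) : volume (box L) = ENNReal.ofReal (L ^ 3) := by
  rw [box, volume_pi_pi]
  simp [ENNReal.ofReal_pow hL.le]

lemma bm_prob {L : ℝ} (hL : 0 < L) : IsProbabilityMeasure (bm L) := by
  constructor
  rw [bm, Measure.smul_apply, Measure.restrict_apply_univ, box_vol hL, smul_eq_mul,
    ← ENNReal.ofReal_mul (by positivity), inv_mul_cancel₀ (by positivity), ENNReal.ofReal_one]

lemma int_exp1 {L : ℝ} (hL : 0 < L) (n : ℤ) (hn : n ≠ 0) :
    ∫ x in Set.Icc (0:ℝ) L, Complex.exp (-Complex.I * ((2 * π / L * (n:ℝ) * x : ℝ) : ℂ)) = 0 := by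
  rw [integral_Icc_eq_integral_Ioc, ← intervalIntegral.integral_of_le hL.le]
  have hc : (-Complex.I * ((2 * π / L * (n:ℝ) : ℝ) : ℂ)) ≠ 0 := by
    apply mul_ne_zero (by simp)
    have : (2 * π / L * (n:ℝ) : ℝ) ≠ 0 := by
      have : (n:ℝ) ≠ 0 := by exact_mod_cast hn
      positivity
    exact_mod_cast this
  have := integral_exp_mul_complex (a := 0) (b := L) hc
  calc _ = ∫ x in (0:ℝ)..L, Complex.exp ((-Complex.I * ((2 * π / L * (n:ℝ) : ℝ) : ℂ)) * x) := by
        congr 1; ext x; congr 1; push_cast; ring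
    _ = _ := by
        rw [this, div_eq_zero_iff]; left
        rw [sub_eq_zero]
        simp only [Complex.ofReal_zero, mul_zero, Complex.exp_zero]
        rw [Complex.exp_eq_one_iff]
        refine ⟨-n, ?_⟩
        have : (L:ℂ) ≠ 0 := by exact_mod_cast hL.ne'
        push_cast
        field_simp

lemma int_em {L : ℝ} (hL : 0 < L) (k : Lat) :
    ∫ x, em L k x ∂(bm L) = if k = 0 then 1 else 0 := by
  have := bm_prob hL
  split_ifs with h
  · subst h; simp [em_zero]
  · obtain ⟨i, hi⟩ : ∃ i, k i ≠ 0 := by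
      by_contra hcon; push Not at hcon; exact h (funext hcon)
    rw [bm, integral_smul_measure]
    have e1 : ∀ x, em L k x = ∏ i, Complex.exp (-Complex.I * ((2 * π / L * (k i:ℝ) * x i : ℝ) : ℂ)) := by
      intro x
      unfold em
      rw [← Complex.exp_sum]; congr 1
      simp only [freq, Fin.sum_univ_three]; push_cast; ring
    have : ∫ x in box L, em L k x = 0 := by
      simp_rw [e1]
      rw [box, volume_pi, Measure.restrict_pi_pi,
        integral_fintype_prod_eq_prod (fun i (x:ℝ) => Complex.exp (-Complex.I * ((2 * π / L * (k i:ℝ) * x : ℝ) : ℂ)))]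
      exact Finset.prod_eq_zero (Finset.mem_univ i) (int_exp1 hL _ hi)
    rw [this, smul_zero]

/-- quotient map to the torus -/
def qm (L : ℝ) (x : Pt) : UnitAddTorus (Fin 3) := fun i => ((x i / L : ℝ) : UnitAddCircle)

lemma qm_cont (L : ℝ) : Continuous (qm L) := by
  unfold qm
  refine continuous_pi fun i => ?_
  exact (AddCircle.continuous_mk' 1).comp (by fun_prop)

lemma mF_qm {L : ℝ} (k : Lat) (x : Pt) :
    UnitAddTorus.mFourier k (qm L x) = em L (-k) x := by
  simp only [UnitAddTorus.mFourier, ContinuousMap.coe_mk, qm]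
  simp_rw [fourier_coe_apply]
  rw [← Complex.exp_sum, em]; congr 1
  simp only [freq, Fin.sum_univ_three, Pi.neg_apply]; push_cast; ring

/-- half open box -/
def hbox (L : ℝ) : Set Pt := Set.univ.pi fun _ => Set.Ico (0 : ℝ) L

lemma qm_inj {L : ℝ} (hL : 0 < L) : Set.InjOn (qm L) (hbox L) := by
  intro x hx y hy h
  ext i
  have hi := congrFun h i
  simp only [qm] at hi
  have hx' := hx i trivial
  have hy' := hy i trivial
  have : x i / L = y i / L := by
    refine (AddCircle.coe_eq_coe_iff_of_mem_Ico (p := (1:ℝ)) (a := 0) ?_ ?_).1 hi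
    · exact ⟨by have := hx'.1; positivity, by rw [div_lt_iff₀ hL]; linarith [hx'.2]⟩
    · exact ⟨by have := hy'.1; positivity, by rw [div_lt_iff₀ hL]; linarith [hy'.2]⟩
  field_simp at this
  exact this

lemma hbox_meas (L : ℝ) : MeasurableSet (hbox L) :=
  MeasurableSet.univ_pi fun _ => measurableSet_Ico

lemma hbox_full (L : ℝ) : bm L (hbox L)ᶜ = 0 := by
  rw [bm, Measure.smul_apply]
  have : (volume.restrict (box L)) (hbox L)ᶜ = 0 := by
    rw [Measure.restrict_congr_set (t := hbox L)]
    · rw [Measure.restrict_apply (hbox_meas L).compl]; simp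
    · exact (Measure.pi_Ico_ae_eq_pi_Icc (f := fun _ => 0) (g := fun _ => L)).symm
  simp [this]

lemma int_cont_zero {L : ℝ} (hL : 0 < L) {h : Pt → ℝ} (hi : Integrable h (bm L))
    (h0 : ∀ k, ∫ x, em L k x * (h x : ℂ) ∂(bm L) = 0) (f : C(UnitAddTorus (Fin 3), ℂ)) :
    ∫ x, f (qm L x) * (h x : ℂ) ∂(bm L) = 0 := by
  have hint : ∀ f : C(UnitAddTorus (Fin 3), ℂ), Integrable (fun x => f (qm L x) * (h x : ℂ)) (bm L) := by
    intro f
    refine hi.ofReal.bdd_mul (c := ‖f‖) ?_ ?_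
    · exact (f.continuous.comp (qm_cont L)).aestronglyMeasurable
    · exact Eventually.of_forall fun x => f.norm_coe_le_norm _
  let Λ₀ : C(UnitAddTorus (Fin 3), ℂ) →ₗ[ℂ] ℂ :=
    { toFun := fun f => ∫ x, f (qm L x) * (h x : ℂ) ∂(bm L)
      map_add' := by
        intro f g
        rw [← integral_add (hint f) (hint g)]
        congr 1; ext x; simp; ring
      map_smul' := by
        intro c f
        simp only [RingHom.id_apply, smul_eq_mul]
        rw [← integral_const_mul]
        congr 1; ext x; simp; ring }
  let Λ : C(UnitAddTorus (Fin 3), ℂ) →L[ℂ] ℂ := Λ₀.mkContinuous (∫ x, ‖h x‖ ∂(bm L)) (by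
    intro f
    change ‖∫ x, f (qm L x) * (h x : ℂ) ∂(bm L)‖ ≤ _
    rw [mul_comm, ← integral_const_mul]
    refine norm_integral_le_of_norm_le (hi.norm.const_mul _) ?_
    refine Eventually.of_forall fun x => ?_
    rw [norm_mul, Complex.norm_real]
    gcongr
    exact f.norm_coe_le_norm _)
  have : Λ = 0 := by
    refine ContinuousLinearMap.ext_on (s := Set.range UnitAddTorus.mFourier) ?_ ?_
    · exact Submodule.dense_iff_topologicalClosure_eq_top.2
        (UnitAddTorus.span_mFourier_closure_eq_top (d := Fin 3))
    · rintro _ ⟨k, rfl⟩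
      change ∫ x, UnitAddTorus.mFourier k (qm L x) * (h x : ℂ) ∂(bm L) = 0
      simp_rw [mF_qm]
      exact h0 _
  exact congrArg (fun T : C(UnitAddTorus (Fin 3), ℂ) →L[ℂ] ℂ => T f) this

lemma uniq_real {L : ℝ} (hL : 0 < L) {h : Pt → ℝ} (hi : Integrable h (bm L))
    (h0 : ∀ k, ∫ x, em L k x * (h x : ℂ) ∂(bm L) = 0) : h =ᵐ[bm L] 0 := by
  have := bm_prob hL
  have hm1 : AEMeasurable (fun x => ENNReal.ofReal (h x)) (bm L) := hi.aemeasurable.ennreal_ofReal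
  have hm2 : AEMeasurable (fun x => ENNReal.ofReal (-h x)) (bm L) := hi.neg.aemeasurable.ennreal_ofReal
  have hf1 : IsFiniteMeasure ((bm L).withDensity (fun x => ENNReal.ofReal (h x))) :=
    isFiniteMeasure_withDensity_ofReal hi.2
  have hf2 : IsFiniteMeasure ((bm L).withDensity (fun x => ENNReal.ofReal (-h x))) :=
    isFiniteMeasure_withDensity_ofReal hi.neg.2
  have hmap : ((bm L).withDensity (fun x => ENNReal.ofReal (h x))).map (qm L)
      = ((bm L).withDensity (fun x => ENNReal.ofReal (-h x))).map (qm L) := by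
    apply ext_of_forall_integral_eq_of_IsFiniteMeasure
    intro f
    rw [integral_map (qm_cont L).aemeasurable f.continuous.aestronglyMeasurable,
      integral_map (qm_cont L).aemeasurable f.continuous.aestronglyMeasurable,
      integral_withDensity_eq_integral_toReal_smul₀ hm1 (by simp),
      integral_withDensity_eq_integral_toReal_smul₀ hm2 (by simp)]
    have hb : ∀ x, ‖f (qm L x)‖ ≤ ‖f‖ := fun x => f.norm_coe_le_norm _
    have hfm : AEStronglyMeasurable (fun x => f (qm L x)) (bm L) :=
      (f.continuous.comp (qm_cont L)).aestronglyMeasurable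
    have i1 : Integrable (fun x => (ENNReal.ofReal (h x)).toReal • f (qm L x)) (bm L) := by
      simp_rw [smul_eq_mul]
      refine Integrable.mul_bdd ?_ hfm (Eventually.of_forall hb)
      simpa [ENNReal.toReal_ofReal'] using hi.pos_part
    have i2 : Integrable (fun x => (ENNReal.ofReal (-h x)).toReal • f (qm L x)) (bm L) := by
      simp_rw [smul_eq_mul]
      refine Integrable.mul_bdd ?_ hfm (Eventually.of_forall hb)
      simpa [ENNReal.toReal_ofReal'] using hi.neg_part
    rw [← sub_eq_zero, ← integral_sub i1 i2]
    have := int_cont_zero hL hi h0 ⟨fun x => (f x : ℂ), by fun_prop⟩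
    simp only [ContinuousMap.coe_mk] at this
    simp_rw [← Complex.ofReal_mul] at this
    rw [integral_complex_ofReal] at this
    have h2 : ∫ x, f (qm L x) * h x ∂(bm L) = 0 := by exact_mod_cast this
    rw [← h2]
    congr 1; ext x
    simp only [ENNReal.toReal_ofReal', smul_eq_mul]
    rcases le_total 0 (h x) with hx | hx
    · rw [max_eq_left hx, max_eq_right (by linarith)]; ring
    · rw [max_eq_right hx, max_eq_left (by linarith)]; ring
  have heq : (bm L).withDensity (fun x => ENNReal.ofReal (h x))
      = (bm L).withDensity (fun x => ENNReal.ofReal (-h x)) := by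
    have key : ∀ ν : Measure Pt, ν ≪ bm L → ∀ S, MeasurableSet S →
        ν S = (ν.map (qm L)) (qm L '' (S ∩ hbox L)) := by
      intro ν hν S hS
      have hn : ν (hbox L)ᶜ = 0 := hν (hbox_full L)
      have hmi : MeasurableSet (qm L '' (S ∩ hbox L)) :=
        MeasurableSet.image_of_continuousOn_injOn (hS.inter (hbox_meas L)) (qm_cont L).continuousOn
          ((qm_inj hL).mono Set.inter_subset_right)
      rw [Measure.map_apply (qm_cont L).measurable hmi]
      refine measure_congr ?_
      have hae : ∀ᵐ x ∂ν, x ∈ hbox L := by rw [ae_iff]; exact hn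
      filter_upwards [hae] with x hx
      apply propext
      constructor
      · intro hxS; exact ⟨x, ⟨hxS, hx⟩, rfl⟩
      · rintro ⟨y, ⟨hyS, hy⟩, hxy⟩
        rw [← qm_inj hL hy hx hxy]; exact hyS
    ext S hS
    rw [key _ (withDensity_absolutelyContinuous _ _) S hS,
      key _ (withDensity_absolutelyContinuous _ _) S hS, hmap]
  have hae := (withDensity_eq_iff_of_sigmaFinite hm1 hm2).1 heq
  filter_upwards [hae] with x hx
  have := congrArg ENNReal.toReal hx
  simp only [ENNReal.toReal_ofReal'] at this
  simp only [Pi.zero_apply]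
  rcases le_total 0 (h x) with hx | hx
  · rw [max_eq_left hx, max_eq_right (by linarith)] at this; exact this
  · rw [max_eq_right hx, max_eq_left (by linarith)] at this; linarith

lemma uniq_cplx {L : ℝ} (hL : 0 < L) {h : Pt → ℂ} (hi : Integrable h (bm L))
    (h0 : ∀ k, ∫ x, em L k x * h x ∂(bm L) = 0) : h =ᵐ[bm L] 0 := by
  have hint : ∀ k, Integrable (fun x => em L k x * h x) (bm L) := fun k =>
    hi.bdd_mul (c := 1) (em_cont L k).aestronglyMeasurable
      (Eventually.of_forall fun x => (em_norm L k x).le)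
  have hci : Integrable (fun x => starRingEnd ℂ (h x)) (bm L) :=
    (LinearIsometryEquiv.integrable_comp_iff Complex.conjLIE).2 hi
  have hcint : ∀ k, Integrable (fun x => em L k x * starRingEnd ℂ (h x)) (bm L) := fun k =>
    hci.bdd_mul (c := 1) (em_cont L k).aestronglyMeasurable
      (Eventually.of_forall fun x => (em_norm L k x).le)
  have h0' : ∀ k, ∫ x, em L k x * starRingEnd ℂ (h x) ∂(bm L) = 0 := by
    intro k
    have := congrArg (starRingEnd ℂ) (h0 (-k))
    rw [← integral_conj] at this
    simpa [em_neg] using this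
  have hre := uniq_real hL hi.re (by
    intro k
    have e : ∀ x, em L k x * ((RCLike.re (h x) : ℝ) : ℂ)
        = (1/2 : ℂ) * (em L k x * h x) + (1/2 : ℂ) * (em L k x * starRingEnd ℂ (h x)) := by
      intro x
      have := Complex.add_conj (h x)
      simp only [RCLike.re_to_complex]
      push_cast at this
      linear_combination (-(1/2 : ℂ) * em L k x) * this
    simp_rw [e]
    rw [integral_add ((hint k).const_mul _) ((hcint k).const_mul _), integral_const_mul,
      integral_const_mul, h0, h0']; simp)
  have him := uniq_real hL hi.im (by
    intro k
    have e : ∀ x, em L k x * ((RCLike.im (h x) : ℝ) : ℂ)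
        = (-Complex.I/2 : ℂ) * (em L k x * h x) + (Complex.I/2 : ℂ) * (em L k x * starRingEnd ℂ (h x)) := by
      intro x
      have := Complex.sub_conj (h x)
      simp only [RCLike.im_to_complex]
      push_cast at this
      linear_combination ((Complex.I/2 : ℂ) * em L k x) * this + em L k x * ((h x).im : ℂ) * Complex.I_mul_I
    simp_rw [e]
    rw [integral_add ((hint k).const_mul _) ((hcint k).const_mul _), integral_const_mul,
      integral_const_mul, h0, h0']; simp)
  filter_upwards [hre, him] with x h1 h2
  exact Complex.ext h1 h2

lemma hs_conv {f g : Lat → ℂ} {a b : ℂ} (h : HasSum f a) (hf : ∀ k, g k = f k) (hb : b = a) :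
    HasSum g b := by
  rw [hb, funext hf]; exact h

lemma em_memLp {L : ℝ} (hL : 0 < L) (k : Lat) : MemLp (em L k) 2 (bm L) := by
  have := bm_prob hL
  exact MemLp.of_bound (em_cont L k).aestronglyMeasurable 1
    (Eventually.of_forall fun x => (em_norm L k x).le)

/-- the exponential basis in `L²` -/
def ee {L : ℝ} (hL : 0 < L) (k : Lat) : Lp ℂ 2 (bm L) := (em_memLp hL (-k)).toLp

lemma inner_ee {L : ℝ} (hL : 0 < L) (k : Lat) (F : Lp ℂ 2 (bm L)) :
    inner ℂ (ee hL k) F = ∫ x, em L k x * F x ∂(bm L) := by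
  rw [L2.inner_def]
  refine integral_congr_ae ?_
  filter_upwards [(em_memLp hL (-k)).coeFn_toLp] with x hx
  rw [ee, hx, RCLike.inner_apply, ← em_neg, neg_neg, mul_comm]

lemma inner_ee_toLp {L : ℝ} (hL : 0 < L) (k : Lat) {g : Pt → ℂ} (hg : MemLp g 2 (bm L)) :
    inner ℂ (ee hL k) hg.toLp = ∫ x, em L k x * g x ∂(bm L) := by
  rw [inner_ee]
  refine integral_congr_ae ?_
  filter_upwards [hg.coeFn_toLp] with x hx
  rw [hx]

lemma ee_orthonormal {L : ℝ} (hL : 0 < L) : Orthonormal ℂ (ee hL) := by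
  rw [orthonormal_iff_ite]
  intro i j
  conv_lhs => rw [ee.eq_1 hL j]
  rw [inner_ee_toLp]
  simp_rw [← em_add]
  rw [int_em hL]
  congr 1
  rw [eq_iff_iff, ← sub_eq_add_neg, sub_eq_zero]

lemma ee_summable {L : ℝ} (hL : 0 < L) {w : Lat → ℂ} (hw : Summable fun k => ‖w k‖ ^ 2) :
    Summable fun k => w k • ee hL k := by
  have := (ee_orthonormal hL).orthogonalFamily.summable_iff_norm_sq_summable (f := w)
  simp only [LinearIsometry.toSpanSingleton_apply] at this
  exact this.2 hw

lemma inner_ee_tsum {L : ℝ} (hL : 0 < L) {w : Lat → ℂ} (hw : Summable fun k => ‖w k‖ ^ 2)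
    (k : Lat) : inner ℂ (ee hL k) (∑' m, w m • ee hL m) = w k := by
  have h1 := (ee_summable hL hw).hasSum.mapL (innerSL ℂ (ee hL k))
  simp only [innerSL_apply_apply, inner_smul_right] at h1
  rw [← h1.tsum_eq, tsum_eq_single k]
  · rw [orthonormal_iff_ite.1 (ee_orthonormal hL)]; simp
  · intro m hm
    rw [orthonormal_iff_ite.1 (ee_orthonormal hL), if_neg hm.symm, mul_zero]

lemma em_mul_int {L : ℝ} {h : Pt → ℂ} (hi : Integrable h (bm L)) (k : Lat) :
    Integrable (fun x => em L k x * h x) (bm L) :=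
  hi.bdd_mul (c := 1) (em_cont L k).aestronglyMeasurable
      (Eventually.of_forall fun x => (em_norm L k x).le)

/-- integrable with square summable coefficients implies `L²` with Fourier expansion -/
lemma expand {L : ℝ} (hL : 0 < L) {g : Pt → ℝ} (hg : Integrable g (bm L))
    (hs : Summable fun k => ‖fcS L g k‖ ^ 2) :
    ∃ hm : MemLp (fun x => (g x : ℂ)) 2 (bm L),
      HasSum (fun k => fcS L g k • ee hL k) hm.toLp := by
  have := bm_prob hL
  set G : Lp ℂ 2 (bm L) := ∑' m, fcS L g m • ee hL m with hG
  have hGi : Integrable G (bm L) := (Lp.memLp G).integrable (by norm_num)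
  have hae : (fun x => (g x : ℂ) - G x) =ᵐ[bm L] 0 := by
    refine uniq_cplx hL (hg.ofReal.sub hGi) ?_
    intro k
    have e : ∀ x, em L k x * ((g x : ℂ) - G x) = em L k x * (g x : ℂ) - em L k x * G x := by
      intro x; ring
    simp_rw [e]
    have hgc : Integrable (fun x => (g x : ℂ)) (bm L) := hg.ofReal
    rw [integral_sub (em_mul_int hgc k) (em_mul_int hGi k), ← inner_ee hL,
      hG, inner_ee_tsum hL hs, fcS_eq hL, sub_self]
  have hae' : G =ᵐ[bm L] fun x => (g x : ℂ) := by
    filter_upwards [hae] with x hx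
    exact (sub_eq_zero.1 hx).symm
  have hm : MemLp (fun x => (g x : ℂ)) 2 (bm L) := (memLp_congr_ae hae').1 (Lp.memLp G)
  refine ⟨hm, ?_⟩
  have : hm.toLp = G := by
    apply Lp.ext
    filter_upwards [hm.coeFn_toLp, hae'] with x h1 h2
    rw [h1, h2]
  rw [this]
  exact (ee_summable hL hs).hasSum

lemma conv_formula {L : ℝ} (hL : 0 < L) {g h : Pt → ℝ} (hg : Integrable g (bm L))
    (hh : Integrable h (bm L))
    (hsg : Summable fun k => ‖fcS L g k‖ ^ 2) (hsh : Summable fun k => ‖fcS L h k‖ ^ 2) (k : Lat) :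
    HasSum (fun m => fcS L g m * fcS L h (k - m)) (fcS L (fun x => g x * h x) k) := by
  obtain ⟨mg, sg⟩ := expand hL hg hsg
  obtain ⟨mh, -⟩ := expand hL hh hsh
  have mw : MemLp (fun x => em L (-k) x * (h x : ℂ)) 2 (bm L) := by
    refine MemLp.of_le mh ((em_cont L _).aestronglyMeasurable.mul mh.1) ?_
    refine Eventually.of_forall fun x => ?_
    rw [norm_mul, em_norm, one_mul]
  have key : ∀ (f : Pt → ℂ) (mf : MemLp f 2 (bm L)),
      inner ℂ mw.toLp mf.toLp = ∫ x, em L k x * (h x : ℂ) * f x ∂(bm L) := by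
    intro f mf
    rw [L2.inner_def]
    refine integral_congr_ae ?_
    filter_upwards [mw.coeFn_toLp, mf.coeFn_toLp] with x h1 h2
    rw [h1, h2, RCLike.inner_apply, map_mul, ← em_neg, neg_neg, Complex.conj_ofReal, mul_comm]
  have h1 := sg.mapL (innerSL ℂ mw.toLp)
  simp only [innerSL_apply_apply, inner_smul_right] at h1
  rw [key] at h1
  have e1 : ∀ m, inner ℂ mw.toLp (ee hL m) = fcS L h (k - m) := by
    intro m
    rw [ee, key, fcS_eq hL]
    congr 1; ext x
    rw [sub_eq_add_neg, em_add]; ring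
  simp_rw [e1] at h1
  refine hs_conv h1 (fun _ => rfl) ?_
  rw [fcS_eq hL]
  congr 1; ext x; push_cast; ring

lemma fcS_zero_of_not {L : ℝ} (hL : 0 < L) {B : Pt → ℝ}
    (hB : ¬ AEStronglyMeasurable B (bm L)) (k : Lat) : fcS L B k = 0 := by
  rw [fcS_eq hL]
  apply integral_undef
  intro hi
  apply hB
  have h2 := (em_mul_int hi (-k)).re.1
  refine h2.congr (Eventually.of_forall fun x => ?_)
  simp only []
  rw [← mul_assoc, ← em_add]
  simp [em_zero]

/-- positivity of the multiplication operator in Fourier variables -/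
lemma pos_form {L : ℝ} (hL : 0 < L) {B : Pt → ℝ} (hB0 : ∀ x, 0 ≤ B x) (hB1 : ∀ x, B x ≤ 1)
    {w : Lat → ℂ} (hw : Summable fun k => ‖w k‖ ^ 2) :
    (∀ k, Summable fun m => fcS L B (k - m) * w m) ∧
    ∃ z : ℂ, 0 ≤ z.re ∧
      HasSum (fun k => starRingEnd ℂ (w k) * ∑' m, fcS L B (k - m) * w m) z := by
  have := bm_prob hL
  by_cases hB : AEStronglyMeasurable B (bm L)
  swap
  · simp_rw [fcS_zero_of_not hL hB]
    simp only [zero_mul, tsum_zero, mul_zero]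
    exact ⟨fun _ => summable_zero, 0, by simp, hasSum_zero⟩
  set W : Lp ℂ 2 (bm L) := ∑' m, w m • ee hL m with hW
  have hWs : HasSum (fun m => w m • ee hL m) W := (ee_summable hL hw).hasSum
  have hBn : ∀ x, ‖(B x : ℂ)‖ ≤ 1 := by
    intro x; rw [Complex.norm_real, Real.norm_of_nonneg (hB0 x)]; exact hB1 x
  have hBm : AEStronglyMeasurable (fun x => (B x : ℂ)) (bm L) :=
    Complex.continuous_ofReal.comp_aestronglyMeasurable hB
  have mB : ∀ {f : Pt → ℂ}, MemLp f 2 (bm L) → MemLp (fun x => (B x : ℂ) * f x) 2 (bm L) := by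
    intro f mf
    refine MemLp.of_le mf (hBm.mul mf.1) ?_
    refine Eventually.of_forall fun x => ?_
    rw [norm_mul]
    exact mul_le_of_le_one_left (norm_nonneg _) (hBn x)
  have key : ∀ (f : Pt → ℂ) (mf : MemLp f 2 (bm L)) (G : Lp ℂ 2 (bm L)),
      inner ℂ (mB mf).toLp G = ∫ x, starRingEnd ℂ (f x) * (B x : ℂ) * G x ∂(bm L) := by
    intro f mf G
    rw [L2.inner_def]
    refine integral_congr_ae ?_
    filter_upwards [(mB mf).coeFn_toLp] with x h1
    rw [h1, RCLike.inner_apply, map_mul, Complex.conj_ofReal]; ring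
  have hk : ∀ k, HasSum (fun m => fcS L B (k - m) * w m)
      (inner ℂ (ee hL k) (mB (Lp.memLp W)).toLp) := by
    intro k
    have h1 := hWs.mapL (innerSL ℂ (mB (em_memLp hL (-k))).toLp)
    simp only [innerSL_apply_apply, inner_smul_right] at h1
    refine hs_conv h1 ?_ ?_
    · intro m
      rw [key _ (em_memLp hL (-k)), fcS_eq hL, mul_comm]
      congr 1
      refine integral_congr_ae ?_
      filter_upwards [(em_memLp hL (-m)).coeFn_toLp] with x hx
      rw [ee, hx, ← em_neg, neg_neg, sub_eq_add_neg, em_add]; ring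
    · rw [key _ (em_memLp hL (-k)), inner_ee_toLp]
      congr 1; ext x
      rw [← em_neg, neg_neg]; ring
  refine ⟨fun k => (hk k).summable, inner ℂ W (mB (Lp.memLp W)).toLp, ?_, ?_⟩
  · rw [L2.inner_def]
    have e : ∫ x, inner ℂ (W x) (((mB (Lp.memLp W)).toLp : Lp ℂ 2 (bm L)) x) ∂(bm L)
        = ∫ x, ((B x * ‖W x‖ ^ 2 : ℝ) : ℂ) ∂(bm L) := by
      refine integral_congr_ae ?_
      filter_upwards [(mB (Lp.memLp W)).coeFn_toLp] with x hx
      rw [hx, RCLike.inner_apply, mul_assoc, Complex.mul_conj, Complex.normSq_eq_norm_sq]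
      push_cast; ring
    rw [e, integral_complex_ofReal, Complex.ofReal_re]
    exact integral_nonneg fun x => mul_nonneg (hB0 x) (by positivity)
  · have h1 := hWs.mapL (innerSL ℂ (mB (Lp.memLp W)).toLp)
    have h2 := h1.star
    simp only [innerSL_apply_apply, inner_smul_right] at h2
    refine hs_conv h2 ?_ ?_
    · intro k
      rw [(hk k).tsum_eq]
      simp
    · simp

lemma freqNormSq_nonneg (L : ℝ) (k : Lat) : 0 ≤ freqNormSq L k :=
  Finset.sum_nonneg fun _ _ => sq_nonneg _

lemma cnormSq_eq (c : Fin 3 → ℂ) : cnormSq c = ∑ i, ‖c i‖ ^ 2 := by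
  simp [cnormSq, Complex.normSq_eq_norm_sq]

lemma cnormSq_nonneg (c : Fin 3 → ℂ) : 0 ≤ cnormSq c := by
  rw [cnormSq_eq]; positivity

lemma le_cnormSq (c : Fin 3 → ℂ) (i : Fin 3) : ‖c i‖ ^ 2 ≤ cnormSq c := by
  rw [cnormSq_eq]
  exact Finset.single_le_sum (f := fun i => ‖c i‖ ^ 2) (fun _ _ => by positivity) (Finset.mem_univ i)

lemma freq_sq_le (L : ℝ) (k : Lat) (a : Fin 3) : freq L k a ^ 2 ≤ freqNormSq L k :=
  Finset.single_le_sum (f := fun i => freq L k i ^ 2) (fun _ _ => by positivity) (Finset.mem_univ a)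

lemma homSummable_zero {L : ℝ} {g : Pt → Vec} (h : homSummable L 0 g) :
    Summable fun k => cnormSq (fc L g k) := by
  simpa [homSummable] using h

lemma comp_summable {L : ℝ} {g : Pt → Vec} (h : Summable fun k => cnormSq (fc L g k)) (i : Fin 3) :
    Summable fun k => ‖fc L g k i‖ ^ 2 :=
  Summable.of_nonneg_of_le (fun _ => by positivity) (fun k => le_cnormSq _ i) h

lemma sob_summable_zero {L : ℝ} {g : Pt → Vec} (h : sobSummable L 1 g) :
    Summable fun k => cnormSq (fc L g k) := by
  refine Summable.of_nonneg_of_le (fun _ => cnormSq_nonneg _) (fun k => ?_) h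
  rw [Real.rpow_one]
  nlinarith [freqNormSq_nonneg L k, cnormSq_nonneg (fc L g k)]

lemma filter_comp {L α : ℝ} (hL : 0 < L) {B : Pt → ℝ} (hB0 : ∀ x, 0 ≤ B x)
    (hB1 : ∀ x, B x ≤ 1) {v g : Pt → Vec} (hv : sobSummable L 1 v)
    (hg : Summable fun k => cnormSq (fc L g k)) (hF : FilterEq L α B v g) (i : Fin 3) :
    ∑' k, ‖fc L v k i‖ ^ 2 ≤ ∑' k, ‖fc L g k i‖ ^ 2 := by
  have hvi := comp_summable (sob_summable_zero hv) i
  have hgi := comp_summable hg i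
  have hw : ∀ a : Fin 3, Summable fun m : Lat => ‖((freq L m a : ℝ) : ℂ) * fc L v m i‖ ^ 2 := by
    intro a
    refine Summable.of_nonneg_of_le (fun _ => by positivity) (fun k => ?_) hv
    rw [Real.rpow_one, norm_mul, mul_pow, Complex.norm_real, Real.norm_eq_abs, sq_abs]
    have h1 := freq_sq_le L k a
    have h2 := le_cnormSq (fc L v k) i
    have h3 := freqNormSq_nonneg L k
    gcongr
    linarith
  have hp := fun a => pos_form hL hB0 hB1 (hw a)
  choose hs z hz hsum using hp
  have hinner : ∀ k : Lat, starRingEnd ℂ (fc L v k i) *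
      (∑' m : Lat, ((∑ a, freq L k a * freq L m a : ℝ) : ℂ) *
        fcS L B (fun a => k a - m a) * fc L v m i)
      = ∑ a, starRingEnd ℂ (((freq L k a : ℝ) : ℂ) * fc L v k i) *
          ∑' m, fcS L B (k - m) * (((freq L m a : ℝ) : ℂ) * fc L v m i) := by
    intro k
    have e1 : ∀ m : Lat, ((∑ a, freq L k a * freq L m a : ℝ) : ℂ) *
        fcS L B (fun a => k a - m a) * fc L v m i
        = ∑ a, ((freq L k a : ℝ) : ℂ) * (fcS L B (k - m) * (((freq L m a : ℝ) : ℂ) * fc L v m i)) := by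
      intro m
      change _ * fcS L B (k - m) * _ = _
      simp only [Fin.sum_univ_three]; push_cast; ring
    simp_rw [e1]
    rw [Summable.tsum_finsetSum (fun a _ => (hs a k).mul_left _), Finset.mul_sum]
    refine Finset.sum_congr rfl fun a _ => ?_
    rw [tsum_mul_left, map_mul, Complex.conj_ofReal]; ring
  have hS : HasSum (fun k => starRingEnd ℂ (fc L v k i) *
      (∑' m : Lat, ((∑ a, freq L k a * freq L m a : ℝ) : ℂ) *
        fcS L B (fun a => k a - m a) * fc L v m i)) (∑ a, z a) := by
    refine hs_conv (hasSum_sum (s := Finset.univ) fun a _ => hsum a) hinner rfl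
  have hre := Complex.hasSum_re hS
  have hzr : 0 ≤ (∑ a, z a).re := by
    rw [Complex.re_sum]; exact Finset.sum_nonneg fun a _ => hz a
  set X := fun k => starRingEnd ℂ (fc L v k i) *
      (∑' m : Lat, ((∑ a, freq L k a * freq L m a : ℝ) : ℂ) *
        fcS L B (fun a => k a - m a) * fc L v m i) with hX
  have hpt : ∀ k, α ^ 2 * (X k).re + ‖fc L v k i‖ ^ 2
      ≤ (1/2) * ‖fc L v k i‖ ^ 2 + (1/2) * ‖fc L g k i‖ ^ 2 := by
    intro k
    have h1 := hF k i
    have h2 : ((α ^ 2 : ℝ) : ℂ) * X k + ((‖fc L v k i‖ ^ 2 : ℝ) : ℂ)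
        = starRingEnd ℂ (fc L v k i) * fc L g k i := by
      rw [← h1, filterLHS, hX]
      have : starRingEnd ℂ (fc L v k i) * fc L v k i = ((‖fc L v k i‖ ^ 2 : ℝ) : ℂ) := by
        rw [mul_comm, Complex.mul_conj, Complex.normSq_eq_norm_sq]
      rw [← this]
      ring
    have h3 := congrArg Complex.re h2
    rw [Complex.add_re, Complex.re_ofReal_mul, Complex.ofReal_re] at h3
    rw [h3]
    have h4 := Complex.re_le_norm (starRingEnd ℂ (fc L v k i) * fc L g k i)
    rw [norm_mul, RCLike.norm_conj] at h4
    nlinarith [sq_nonneg (‖fc L v k i‖ - ‖fc L g k i‖)]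
  have hle := hasSum_le hpt ((hre.mul_left (α ^ 2)).add hvi.hasSum)
    ((hvi.hasSum.mul_left (1/2)).add (hgi.hasSum.mul_left (1/2)))
  have : 0 ≤ α ^ 2 * (∑ a, z a).re := by positivity
  linarith

lemma homSobSq_zero {L : ℝ} (g : Pt → Vec) :
    homSobSq L 0 g = L ^ 3 * ∑' k, cnormSq (fc L g k) := by
  simp [homSobSq]

lemma filter_bound {L α : ℝ} (hL : 0 < L) {B : Pt → ℝ} (hB0 : ∀ x, 0 ≤ B x)
    (hB1 : ∀ x, B x ≤ 1) {v g : Pt → Vec} (hv : sobSummable L 1 v)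
    (hg : Summable fun k => cnormSq (fc L g k)) (hF : FilterEq L α B v g) :
    ∑' k, cnormSq (fc L v k) ≤ ∑' k, cnormSq (fc L g k) := by
  simp_rw [cnormSq_eq]
  rw [Summable.tsum_finsetSum fun i _ => comp_summable (sob_summable_zero hv) i,
    Summable.tsum_finsetSum fun i _ => comp_summable hg i]
  exact Finset.sum_le_sum fun i _ => filter_comp hL hB0 hB1 hv hg hF i

lemma sum1d (n : ℕ) : ∑ j ∈ Finset.Icc (-(n:ℤ)) n, (max 1 |(j:ℝ)|) ^ (-(2/3:ℝ))
    ≤ 1 + 6 * (n:ℝ) ^ (1/3:ℝ) := by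
  induction n with
  | zero => simp
  | succ n ih =>
    have e : Finset.Icc (-((n+1:ℕ):ℤ)) ((n+1:ℕ):ℤ)
        = insert (-((n+1:ℕ):ℤ)) (insert ((n+1:ℕ):ℤ) (Finset.Icc (-(n:ℤ)) n)) := by
      ext j; simp only [Finset.mem_Icc, Finset.mem_insert]; push_cast; omega
    rw [e, Finset.sum_insert, Finset.sum_insert]
    rotate_left
    · simp
    · simp only [Finset.mem_Icc, Finset.mem_insert]; push_cast; omega
    have hn : (0:ℝ) ≤ n := by positivity
    have hm : max 1 |(((n+1:ℕ):ℤ):ℝ)| = (n:ℝ)+1 := by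
      push_cast; rw [abs_of_nonneg (by linarith)]; exact max_eq_right (by linarith)
    have hm' : max 1 |((-((n+1:ℕ):ℤ):ℤ):ℝ)| = (n:ℝ)+1 := by
      push_cast; rw [abs_neg, abs_of_nonneg (by linarith)]
      exact max_eq_right (by linarith)
    rw [hm, hm']
    set x := (n:ℝ) ^ (1/3:ℝ) with hx
    set y := ((n:ℝ)+1) ^ (1/3:ℝ) with hy
    have hx0 : 0 ≤ x := by positivity
    have hy0 : 0 < y := by positivity
    have hxy : x ≤ y := Real.rpow_le_rpow hn (by linarith) (by norm_num)
    have hx3 : x ^ 3 = n := by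
      rw [hx, ← Real.rpow_natCast, ← Real.rpow_mul hn]; norm_num
    have hy3 : y ^ 3 = n + 1 := by
      rw [hy, ← Real.rpow_natCast, ← Real.rpow_mul (by linarith)]; norm_num
    have hy2 : ((n:ℝ)+1) ^ (-(2/3:ℝ)) = (y ^ 2)⁻¹ := by
      rw [hy, ← Real.rpow_natCast, ← Real.rpow_mul (by linarith), ← Real.rpow_neg (by linarith)]
      norm_num
    rw [hy2]
    have : (y ^ 2)⁻¹ ≤ 3 * (y - x) := by
      rw [inv_le_iff_one_le_mul₀ (by positivity)]
      have h1 : y ^ 3 - x ^ 3 = 1 := by rw [hx3, hy3]; ring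
      have h2 : y ^ 3 - x ^ 3 = (y - x) * (y ^ 2 + x * y + x ^ 2) := by ring
      have h3 : y ^ 2 + x * y + x ^ 2 ≤ 3 * y ^ 2 := by nlinarith
      nlinarith [mul_le_mul_of_nonneg_left h3 (sub_nonneg.2 hxy)]
    push_cast
    rw [← hy]
    linarith

lemma one_le_norm {m : Lat} (hm : m ≠ 0) : 1 ≤ ‖m‖ := by
  obtain ⟨i, hi⟩ : ∃ i, m i ≠ 0 := by
    by_contra hcon; push Not at hcon; exact hm (funext hcon)
  refine le_trans ?_ (norm_le_pi_norm m i)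
  rw [Int.norm_eq_abs]
  exact_mod_cast Int.one_le_abs hi

lemma latsum (G : Finset Lat) {R : ℝ} (hR : 0 ≤ R) :
    ∑ m ∈ G.filter (fun m => m ≠ 0 ∧ ‖m‖ ≤ R), (‖m‖ ^ 2)⁻¹ ≤ 343 * R := by
  classical
  rcases lt_or_ge R 1 with h1 | h1
  · rw [Finset.sum_eq_zero]
    · positivity
    · intro m hm
      obtain ⟨-, h2, h3⟩ := Finset.mem_filter.1 hm
      linarith [one_le_norm h2]
  set n := ⌊R⌋₊ with hn
  have hnR : (n:ℝ) ≤ R := Nat.floor_le hR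
  have hn1 : (1:ℝ) ≤ n := by
    have : 1 ≤ n := Nat.le_floor (by simpa using h1)
    exact_mod_cast this
  calc ∑ m ∈ G.filter (fun m => m ≠ 0 ∧ ‖m‖ ≤ R), (‖m‖ ^ 2)⁻¹
      ≤ ∑ m ∈ G.filter (fun m => m ≠ 0 ∧ ‖m‖ ≤ R), ∏ i : Fin 3, (max 1 |((m i:ℤ):ℝ)|) ^ (-(2/3:ℝ)) := by
        refine Finset.sum_le_sum fun m hm => ?_
        obtain ⟨-, h2, h3⟩ := Finset.mem_filter.1 hm
        have hN := one_le_norm h2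
        have : (‖m‖ ^ 2)⁻¹ = ∏ i : Fin 3, ‖m‖ ^ (-(2/3:ℝ)) := by
          rw [Finset.prod_const, ← Real.rpow_natCast, ← Real.rpow_natCast, ← Real.rpow_mul (by linarith),
            ← Real.rpow_neg (by linarith)]
          norm_num
        rw [this]
        refine Finset.prod_le_prod (fun _ _ => by positivity) fun i _ => ?_
        refine Real.rpow_le_rpow_of_nonpos (by positivity) ?_ (by norm_num)
        refine max_le hN ?_
        have := norm_le_pi_norm m i
        rwa [Int.norm_eq_abs] at this
    _ ≤ ∑ m ∈ Fintype.piFinset (fun _ : Fin 3 => Finset.Icc (-(n:ℤ)) n),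
          ∏ i : Fin 3, (max 1 |((m i:ℤ):ℝ)|) ^ (-(2/3:ℝ)) := by
        refine Finset.sum_le_sum_of_subset_of_nonneg ?_ fun _ _ _ => by positivity
        intro m hm
        obtain ⟨-, h2, h3⟩ := Finset.mem_filter.1 hm
        rw [Fintype.mem_piFinset]
        intro i
        rw [Finset.mem_Icc, ← abs_le]
        have := (norm_le_pi_norm m i).trans h3
        rw [Int.norm_eq_abs] at this
        have h4 : ((m i).natAbs : ℝ) ≤ R := by rw [Nat.cast_natAbs]; exact_mod_cast this
        have h5 := Nat.le_floor h4
        rw [Int.abs_eq_natAbs]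
        exact_mod_cast h5
    _ = (∑ j ∈ Finset.Icc (-(n:ℤ)) n, (max 1 |(j:ℝ)|) ^ (-(2/3:ℝ))) ^ 3 := by
        rw [← Finset.prod_univ_sum (fun _ : Fin 3 => Finset.Icc (-(n:ℤ)) n)
          (fun _ (j : ℤ) => (max 1 |(j:ℝ)|) ^ (-(2/3:ℝ)))]
        simp
    _ ≤ (7 * (n:ℝ) ^ (1/3:ℝ)) ^ 3 := by
        have h0 := sum1d n
        have h2 : (1:ℝ) ≤ (n:ℝ) ^ (1/3:ℝ) := Real.one_le_rpow hn1 (by norm_num)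
        gcongr
        linarith
    _ = 343 * n := by
        rw [mul_pow, ← Real.rpow_natCast ((n:ℝ) ^ (1/3:ℝ)), ← Real.rpow_mul (by positivity)]; norm_num
    _ ≤ 343 * R := by linarith

lemma part1 {a b : Lat → ℝ} (ha0 : a 0 = 0) {A B : ℝ} (F G : Finset Lat)
    (hA : ∑ m ∈ G, ‖m‖ ^ 2 * a m ^ 2 ≤ A) (hB0 : 0 ≤ B)
    (hB : ∀ F : Finset Lat, ∑ m ∈ F, b m ^ 2 ≤ B) :
    ∑ k ∈ F, ‖k‖⁻¹ * (∑ m ∈ G.filter (fun m => ‖m‖ ≤ ‖k‖), a m * b (k - m)) ^ 2 ≤ 343 * (A * B) := by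
  classical
  have hk : ∀ k ∈ F, ‖k‖⁻¹ * (∑ m ∈ G.filter (fun m => ‖m‖ ≤ ‖k‖), a m * b (k - m)) ^ 2
      ≤ 343 * ∑ m ∈ G, (‖m‖ ^ 2 * a m ^ 2) * b (k - m) ^ 2 := by
    intro k _
    have e : ∑ m ∈ G.filter (fun m => ‖m‖ ≤ ‖k‖), a m * b (k - m)
        = ∑ m ∈ G.filter (fun m => m ≠ 0 ∧ ‖m‖ ≤ ‖k‖), ‖m‖⁻¹ * (‖m‖ * a m * b (k - m)) := by
      symm
      refine (Finset.sum_subset_zero_on_sdiff ?_ ?_ ?_)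
      · intro m hm
        simp only [Finset.mem_filter] at hm ⊢
        exact ⟨hm.1, hm.2.2⟩
      · intro m hm
        simp only [Finset.mem_sdiff, Finset.mem_filter, not_and] at hm
        have : m = 0 := by
          by_contra h; exact hm.2 hm.1.1 h hm.1.2
        rw [this, ha0, zero_mul]
      · intro m hm
        simp only [Finset.mem_filter] at hm
        have := one_le_norm hm.2.1
        field_simp
    rw [e]
    have cs := Finset.sum_mul_sq_le_sq_mul_sq (G.filter (fun m => m ≠ 0 ∧ ‖m‖ ≤ ‖k‖))
      (fun m => ‖m‖⁻¹) (fun m => ‖m‖ * a m * b (k - m))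
    have l1 := latsum G (norm_nonneg k)
    simp_rw [inv_pow] at cs
    have l2 : ∑ m ∈ G.filter (fun m => m ≠ 0 ∧ ‖m‖ ≤ ‖k‖), (‖m‖ * a m * b (k - m)) ^ 2
        ≤ ∑ m ∈ G, (‖m‖ ^ 2 * a m ^ 2) * b (k - m) ^ 2 := by
      simp_rw [mul_pow]
      exact Finset.sum_le_sum_of_subset_of_nonneg (Finset.filter_subset _ _) fun _ _ _ => by positivity
    have l3 : 0 ≤ ∑ m ∈ G, (‖m‖ ^ 2 * a m ^ 2) * b (k - m) ^ 2 :=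
      Finset.sum_nonneg fun _ _ => by positivity
    have l4 := mul_le_mul l1 l2 (Finset.sum_nonneg fun _ _ => by positivity) (by positivity)
    calc _ ≤ ‖k‖⁻¹ * (343 * ‖k‖ * ∑ m ∈ G, (‖m‖ ^ 2 * a m ^ 2) * b (k - m) ^ 2) := by
          gcongr; exact cs.trans l4
      _ = (‖k‖⁻¹ * ‖k‖) * (343 * ∑ m ∈ G, (‖m‖ ^ 2 * a m ^ 2) * b (k - m) ^ 2) := by ring
      _ ≤ _ := mul_le_of_le_one_left (by positivity) inv_mul_le_one
  refine (Finset.sum_le_sum hk).trans ?_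
  rw [← Finset.mul_sum, Finset.sum_comm]
  gcongr
  calc ∑ m ∈ G, ∑ k ∈ F, (‖m‖ ^ 2 * a m ^ 2) * b (k - m) ^ 2
      ≤ ∑ m ∈ G, (‖m‖ ^ 2 * a m ^ 2) * B := by
        refine Finset.sum_le_sum fun m _ => ?_
        rw [← Finset.mul_sum]
        gcongr
        have := hB (F.image (fun k => k - m))
        rwa [Finset.sum_image (by intro x _ y _ h; simpa using h)] at this
    _ ≤ A * B := by rw [← Finset.sum_mul]; gcongr

lemma part2 {a b : Lat → ℝ} {A B : ℝ} (F G : Finset Lat)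
    (hA : ∑ m ∈ G, ‖m‖ ^ 2 * a m ^ 2 ≤ A) (hB0 : 0 ≤ B)
    (hB : ∀ F : Finset Lat, ∑ m ∈ F, b m ^ 2 ≤ B) :
    ∑ k ∈ F, ‖k‖⁻¹ * (∑ m ∈ G.filter (fun m => ¬ ‖m‖ ≤ ‖k‖), a m * b (k - m)) ^ 2 ≤ 343 * (A * B) := by
  classical
  set c := fun k : Lat => ∑ m ∈ G.filter (fun m => ¬ ‖m‖ ≤ ‖k‖), a m * b (k - m) with hc
  set S := ∑ k ∈ F, ‖k‖⁻¹ * (c k) ^ 2 with hS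
  have hA0 : 0 ≤ A := le_trans (Finset.sum_nonneg fun _ _ => by positivity) hA
  have hS0 : 0 ≤ S := Finset.sum_nonneg fun _ _ => by positivity
  have cs := Finset.sum_mul_sq_le_sq_mul_sq (F ×ˢ G)
    (fun p : Lat × Lat => (if ¬ ‖p.2‖ ≤ ‖p.1‖ then √(‖p.1‖⁻¹) * a p.2 else 0))
    (fun p : Lat × Lat => √(‖p.1‖⁻¹) * c p.1 * b (p.1 - p.2))
  have hsq : ∀ k : Lat, √(‖k‖⁻¹) ^ 2 = ‖k‖⁻¹ := fun k => Real.sq_sqrt (by positivity)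
  have e1 : ∑ p ∈ F ×ˢ G, (if ¬ ‖p.2‖ ≤ ‖p.1‖ then √(‖p.1‖⁻¹) * a p.2 else 0) *
      (√(‖p.1‖⁻¹) * c p.1 * b (p.1 - p.2)) = S := by
    rw [Finset.sum_product, hS]
    refine Finset.sum_congr rfl fun k _ => ?_
    have hck : c k = ∑ m ∈ G, if ¬ ‖m‖ ≤ ‖k‖ then a m * b (k - m) else 0 := by
      simp only [hc]; rw [Finset.sum_filter]
    rw [sq, ← mul_assoc]
    rw [show ‖k‖⁻¹ * c k * c k = (‖k‖⁻¹ * c k) * ∑ m ∈ G, (if ¬ ‖m‖ ≤ ‖k‖ then a m * b (k - m) else 0) by rw [← hck]]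
    rw [Finset.mul_sum]
    refine Finset.sum_congr rfl fun m _ => ?_
    by_cases h : ‖m‖ ≤ ‖k‖
    · simp [h]
    · simp only [h, not_false_eq_true, if_true]
      linear_combination (c k * a m * b (k - m)) * hsq k
  have e2 : ∑ p ∈ F ×ˢ G, (√(‖p.1‖⁻¹) * c p.1 * b (p.1 - p.2)) ^ 2 ≤ S * B := by
    rw [Finset.sum_product, hS, Finset.sum_mul]
    refine Finset.sum_le_sum fun k _ => ?_
    simp_rw [mul_pow, hsq]
    rw [← Finset.mul_sum]
    gcongr
    have := hB (G.image (fun m => k - m))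
    rwa [Finset.sum_image (by intro x _ y _ h; simpa using h)] at this
  have e3 : ∑ p ∈ F ×ˢ G, (if ¬ ‖p.2‖ ≤ ‖p.1‖ then √(‖p.1‖⁻¹) * a p.2 else 0) ^ 2 ≤ 343 * A := by
    rw [Finset.sum_product_right]
    refine le_trans (b := ∑ m ∈ G, 343 * (‖m‖ ^ 2 * a m ^ 2)) ?_ (by rw [← Finset.mul_sum]; gcongr)
    refine Finset.sum_le_sum fun m _ => ?_
    have h1 : ∀ k ∈ F, (if ¬ ‖m‖ ≤ ‖k‖ then √(‖k‖⁻¹) * a m else 0) ^ 2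
        ≤ a m ^ 2 * ‖m‖ * (if k ≠ 0 ∧ ‖k‖ ≤ ‖m‖ then (‖k‖ ^ 2)⁻¹ else 0) := by
      intro k _
      by_cases h : ‖m‖ ≤ ‖k‖
      · rw [if_neg (not_not.2 h), zero_pow (by norm_num)]
        exact mul_nonneg (by positivity) (by split_ifs <;> positivity)
      · rw [if_pos h, mul_pow, hsq]
        by_cases h0 : k = 0
        · simp [h0]
        · rw [if_pos ⟨h0, (not_le.1 h).le⟩]
          have hk := one_le_norm h0
          have : ‖k‖⁻¹ ≤ ‖m‖ * (‖k‖ ^ 2)⁻¹ := by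
            have : ‖k‖⁻¹ = ‖k‖ * (‖k‖ ^ 2)⁻¹ := by field_simp
            rw [this]
            gcongr
            exact (not_le.1 h).le
          nlinarith [sq_nonneg (a m)]
    refine (Finset.sum_le_sum h1).trans ?_
    rw [← Finset.mul_sum, ← Finset.sum_filter]
    have := latsum F (norm_nonneg m)
    calc _ ≤ a m ^ 2 * ‖m‖ * (343 * ‖m‖) := by gcongr
      _ = _ := by ring
  rw [e1] at cs
  have h5 : S ^ 2 ≤ 343 * A * (S * B) :=
    cs.trans (mul_le_mul e3 e2 (Finset.sum_nonneg fun _ _ => by positivity) (by positivity))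
  rcases hS0.eq_or_lt with h | h
  · rw [← h]; positivity
  · nlinarith

lemma prod_fin {a b : Lat → ℝ} (ha0 : a 0 = 0) {A B : ℝ} (F G : Finset Lat)
    (hA : ∑ m ∈ G, ‖m‖ ^ 2 * a m ^ 2 ≤ A) (hB0 : 0 ≤ B)
    (hB : ∀ F : Finset Lat, ∑ m ∈ F, b m ^ 2 ≤ B) :
    ∑ k ∈ F, ‖k‖⁻¹ * (∑ m ∈ G, a m * b (k - m)) ^ 2 ≤ 1372 * (A * B) := by
  classical
  have h1 := part1 ha0 F G hA hB0 hB
  have h2 := part2 F G hA hB0 hB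
  refine le_trans (b := ∑ k ∈ F, (2 * (‖k‖⁻¹ * (∑ m ∈ G.filter (fun m => ‖m‖ ≤ ‖k‖), a m * b (k - m)) ^ 2)
    + 2 * (‖k‖⁻¹ * (∑ m ∈ G.filter (fun m => ¬ ‖m‖ ≤ ‖k‖), a m * b (k - m)) ^ 2))) ?_ ?_
  · refine Finset.sum_le_sum fun k _ => ?_
    rw [← Finset.sum_filter_add_sum_filter_not G (fun m => ‖m‖ ≤ ‖k‖)]
    have hk : 0 ≤ ‖k‖⁻¹ := by positivity
    nlinarith [mul_nonneg hk (sq_nonneg ((∑ m ∈ G.filter (fun m => ‖m‖ ≤ ‖k‖), a m * b (k - m))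
      - (∑ m ∈ G.filter (fun m => ¬ ‖m‖ ≤ ‖k‖), a m * b (k - m))))]
  · rw [Finset.sum_add_distrib, ← Finset.mul_sum, ← Finset.mul_sum]
    linarith

lemma freq_zero (L : ℝ) (i : Fin 3) : freq L 0 i = 0 := by simp [freq]

lemma freqNormSq_zero (L : ℝ) : freqNormSq L 0 = 0 := by simp [freqNormSq, freq_zero]

lemma freq_lower {L : ℝ} (hL : 0 < L) (k : Lat) : ‖k‖ ≤ L / (2 * π) * √(freqNormSq L k) := by
  have hp := Real.pi_pos
  refine (pi_norm_le_iff_of_nonneg (by positivity)).2 fun i => ?_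
  have h1 : |freq L k i| ≤ √(freqNormSq L k) := Real.abs_le_sqrt (freq_sq_le L k i)
  rw [Int.norm_eq_abs]
  have h2 : |freq L k i| = (2 * π / L) * |(k i : ℝ)| := by
    rw [freq, abs_mul, abs_of_pos (by positivity)]
  rw [h2] at h1
  calc |(k i : ℝ)| = L / (2 * π) * (2 * π / L * |(k i : ℝ)|) := by field_simp
    _ ≤ _ := by gcongr

lemma freqNormSq_pos {L : ℝ} (hL : 0 < L) {k : Lat} (hk : k ≠ 0) : 0 < freqNormSq L k := by
  rcases (freqNormSq_nonneg L k).eq_or_lt with h | h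
  · have h1 := freq_lower hL k
    rw [← h] at h1
    simp at h1
    exact absurd h1 hk
  · exact h

lemma prod_lim {L : ℝ} (hL : 0 < L) {g h : Pt → ℝ} (hg : Integrable g (bm L))
    (hh : Integrable h (bm L))
    (hsg : Summable fun k => ‖fcS L g k‖ ^ 2) (hsh : Summable fun k => ‖fcS L h k‖ ^ 2)
    (h0 : fcS L g 0 = 0) {A : ℝ}
    (hA : ∀ G : Finset Lat, ∑ m ∈ G, ‖m‖ ^ 2 * ‖fcS L g m‖ ^ 2 ≤ A) (F : Finset Lat) :
    ∑ k ∈ F, ‖k‖⁻¹ * ‖fcS L (fun x => g x * h x) k‖ ^ 2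
      ≤ 1372 * (A * ∑' k, ‖fcS L h k‖ ^ 2) := by
  have ht : Tendsto (fun G : Finset Lat => ∑ k ∈ F, ‖k‖⁻¹ *
      ‖∑ m ∈ G, fcS L g m * fcS L h (k - m)‖ ^ 2) atTop
      (𝓝 (∑ k ∈ F, ‖k‖⁻¹ * ‖fcS L (fun x => g x * h x) k‖ ^ 2)) := by
    refine tendsto_finsetSum _ fun k _ => ?_
    have := conv_formula hL hg hh hsg hsh k
    exact ((this.norm).pow 2).const_mul _
  refine le_of_tendsto ht (Eventually.of_forall fun G => ?_)
  refine le_trans ?_ (prod_fin (a := fun m => ‖fcS L g m‖) (b := fun m => ‖fcS L h m‖)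
    (by simp [h0]) F G (hA G) (tsum_nonneg fun _ => by positivity)
    (fun F => hsh.sum_le_tsum F fun _ _ => by positivity))
  refine Finset.sum_le_sum fun k _ => ?_
  gcongr
  refine (norm_sum_le _ _).trans (le_of_eq ?_)
  simp_rw [norm_mul]

lemma cnormSq_cs {L : ℝ} (k : Lat) (c : Fin 3 → ℂ) :
    ‖∑ j, c j * ((freq L k j : ℝ) : ℂ)‖ ^ 2 ≤ cnormSq c * freqNormSq L k := by
  have h1 : ‖∑ j, c j * ((freq L k j : ℝ) : ℂ)‖ ≤ ∑ j, ‖c j‖ * |freq L k j| := by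
    refine (norm_sum_le _ _).trans (le_of_eq ?_)
    simp [norm_mul]
  calc _ ≤ (∑ j, ‖c j‖ * |freq L k j|) ^ 2 := by gcongr
    _ ≤ (∑ j, ‖c j‖ ^ 2) * ∑ j, |freq L k j| ^ 2 := Finset.sum_mul_sq_le_sq_mul_sq _ _ _
    _ = _ := by rw [cnormSq_eq, freqNormSq]; simp_rw [sq_abs]

lemma norm_sub_sq_two (a b : ℂ) : ‖a - b‖ ^ 2 ≤ 2 * ‖a‖ ^ 2 + 2 * ‖b‖ ^ 2 := by
  have h := norm_sub_le a b
  have : ‖a - b‖ ^ 2 ≤ (‖a‖ + ‖b‖) ^ 2 := by gcongr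
  nlinarith [sq_nonneg (‖a‖ - ‖b‖)]

lemma norm_sq_three (a b c : ℂ) : ‖-a - b + c‖ ^ 2 ≤ 3 * ‖a‖ ^ 2 + 3 * ‖b‖ ^ 2 + 3 * ‖c‖ ^ 2 := by
  have h : ‖-a - b + c‖ ≤ ‖a‖ + ‖b‖ + ‖c‖ := by
    refine (norm_add_le _ _).trans ?_
    gcongr
    refine (norm_sub_le _ _).trans ?_
    rw [norm_neg]
  have : ‖-a - b + c‖ ^ 2 ≤ (‖a‖ + ‖b‖ + ‖c‖) ^ 2 := by gcongr
  nlinarith [sq_nonneg (‖a‖ - ‖b‖), sq_nonneg (‖a‖ - ‖c‖), sq_nonneg (‖b‖ - ‖c‖)]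

lemma leray_bound {L : ℝ} (hL : 0 < L) {k : Lat} (hk : k ≠ 0) (c : Fin 3 → ℂ) :
    cnormSq (leray L k c) ≤ 4 * cnormSq c := by
  have hK := freqNormSq_pos hL hk
  have hcs := cnormSq_cs (L := L) k c
  set s := ∑ j, c j * ((freq L k j : ℝ) : ℂ) with hs
  set K := freqNormSq L k with hKd
  have h1 : ∀ i, ‖leray L k c i‖ ^ 2 ≤ 2 * ‖c i‖ ^ 2 + 2 * (‖s‖ ^ 2 / K ^ 2 * freq L k i ^ 2) := by
    intro i
    rw [leray, if_neg hk]
    refine (norm_sub_sq_two _ _).trans (le_of_eq ?_)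
    rw [← hs, ← hKd, norm_mul, norm_div, Complex.norm_real, Complex.norm_real, mul_pow, div_pow]
    simp
  rw [cnormSq_eq]
  refine (Finset.sum_le_sum fun i _ => h1 i).trans ?_
  rw [Finset.sum_add_distrib, ← Finset.mul_sum, ← Finset.mul_sum, ← Finset.mul_sum, ← cnormSq_eq]
  have h2 : ∑ i, freq L k i ^ 2 = K := rfl
  rw [h2]
  have h3 : ‖s‖ ^ 2 / K ^ 2 * K ≤ cnormSq c := by
    rw [show ‖s‖ ^ 2 / K ^ 2 * K = ‖s‖ ^ 2 / K by field_simp, div_le_iff₀ hK]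
    exact hcs
  linarith

lemma transport_bound (L : ℝ) (u v : Pt → Vec) (k : Lat) :
    cnormSq (transportCoef L u v k)
      ≤ freqNormSq L k * ∑ i, ∑ j, ‖fcS L (fun x => u x i * v x j) k‖ ^ 2 := by
  rw [cnormSq_eq, Finset.mul_sum]
  refine Finset.sum_le_sum fun i _ => ?_
  have h := cnormSq_cs (L := L) k (fun j => fcS L (fun x => u x i * v x j) k)
  rw [cnormSq_eq] at h
  rw [transportCoef, norm_mul, Complex.norm_I, one_mul, mul_comm (freqNormSq L k)]
  simp_rw [mul_comm ((freq L k _ : ℝ) : ℂ)]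
  exact h

lemma weight {K : ℝ} (hK : 0 < K) : (1 + K) ^ (-(3:ℝ)/2) ≤ K⁻¹ ∧
    (1 + K) ^ (-(3:ℝ)/2) * K ≤ (√K)⁻¹ ∧ (1 + K) ^ (-(3:ℝ)/2) * K ^ 2 ≤ K := by
  have h1 : (1 + K) ^ (-(3:ℝ)/2) = ((1 + K) * √(1 + K))⁻¹ := by
    rw [Real.sqrt_eq_rpow, mul_comm, ← Real.rpow_add_one (by positivity), ← Real.rpow_neg (by positivity)]
    norm_num
  rw [h1]
  have h2 : 1 ≤ √(1 + K) := Real.one_le_sqrt.2 (by linarith)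
  have h3 : √K ≤ √(1 + K) := Real.sqrt_le_sqrt (by linarith)
  have h4 : 0 < √K := Real.sqrt_pos.2 hK
  have e1 : ((1 + K) * √(1 + K))⁻¹ ≤ K⁻¹ := by
    apply inv_anti₀ hK; nlinarith
  refine ⟨e1, ?_, ?_⟩
  · rw [inv_mul_le_iff₀ (by positivity), ← div_eq_mul_inv, le_div_iff₀ h4]
    nlinarith
  · calc _ ≤ K⁻¹ * K ^ 2 := by gcongr
      _ = K := by field_simp

lemma term_bound {L ν : ℝ} (hL : 0 < L) (u v : Pt → Vec) (hu : ZeroMean L u)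
    (c : Fin 3 → ℂ) (k : Lat) (hc : k = 0 → c = 0) :
    (1 + freqNormSq L k) ^ (-(3 : ℝ) / 2) *
      (cnormSq fun i => -(((ν * freqNormSq L k : ℝ) : ℂ) * fc L u k i)
                - leray L k (transportCoef L u v k) i + c i)
    ≤ 3 * ν ^ 2 * (freqNormSq L k ^ (1:ℝ) * cnormSq (fc L u k))
      + 12 * (L / (2 * π)) * ∑ i, ∑ j, ‖k‖⁻¹ * ‖fcS L (fun x => u x i * v x j) k‖ ^ 2
      + 3 * (freqNormSq L k ^ (-(1:ℝ)) * cnormSq c) := by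
  have hp := Real.pi_pos
  by_cases hk : k = 0
  · subst hk
    have h1 : ∀ i, fc L u 0 i = 0 := hu
    have : ∀ i, transportCoef L u v 0 i = 0 := by
      intro i; simp [transportCoef, freq_zero]
    simp [leray, this, h1, hc rfl, freqNormSq_zero, cnormSq]
  have hK := freqNormSq_pos hL hk
  have h3 : (cnormSq fun i => -(((ν * freqNormSq L k : ℝ) : ℂ) * fc L u k i)
                - leray L k (transportCoef L u v k) i + c i)
      ≤ 3 * (ν ^ 2 * freqNormSq L k ^ 2 * cnormSq (fc L u k))
        + 3 * cnormSq (leray L k (transportCoef L u v k)) + 3 * cnormSq c := by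
    simp_rw [cnormSq_eq]
    refine (Finset.sum_le_sum fun i _ => norm_sq_three _ _ _).trans (le_of_eq ?_)
    have hn : ∀ i, ‖((ν * freqNormSq L k : ℝ) : ℂ) * fc L u k i‖ ^ 2
        = ν ^ 2 * freqNormSq L k ^ 2 * ‖fc L u k i‖ ^ 2 := by
      intro i
      rw [norm_mul, Complex.norm_real, mul_pow, Real.norm_eq_abs, sq_abs, mul_pow]
    simp only [hn, Fin.sum_univ_three]
    ring
  obtain ⟨w1, w2, w3⟩ := weight hK
  have hw0 : 0 ≤ (1 + freqNormSq L k) ^ (-(3:ℝ)/2) := by positivity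
  set w := (1 + freqNormSq L k) ^ (-(3:ℝ)/2) with hw
  set K := freqNormSq L k with hKd
  have hl := (leray_bound hL hk (transportCoef L u v k)).trans
    (mul_le_mul_of_nonneg_left (transport_bound L u v k) (by norm_num))
  set Q := ∑ i, ∑ j, ‖fcS L (fun x => u x i * v x j) k‖ ^ 2 with hQ
  have hQ0 : 0 ≤ Q := by positivity
  have hQ' : ∑ i, ∑ j, ‖k‖⁻¹ * ‖fcS L (fun x => u x i * v x j) k‖ ^ 2 = ‖k‖⁻¹ * Q := by
    simp_rw [hQ, Finset.mul_sum]
  rw [hQ', Real.rpow_one, Real.rpow_neg_one]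
  have hn : (√K)⁻¹ ≤ L / (2 * π) * ‖k‖⁻¹ := by
    have := freq_lower hL k
    have hk1 := one_le_norm hk
    have hsK : 0 < √K := Real.sqrt_pos.2 hK
    rw [← div_eq_mul_inv, le_div_iff₀ (by linarith), inv_mul_le_iff₀ hsK, mul_comm]
    exact this
  have a0 := cnormSq_nonneg (fc L u k)
  have b0 := cnormSq_nonneg c
  have t1 : w * K ^ 2 * cnormSq (fc L u k) ≤ K * cnormSq (fc L u k) := by gcongr
  have t2 : w * K * Q ≤ L / (2 * π) * ‖k‖⁻¹ * Q := mul_le_mul_of_nonneg_right (w2.trans hn) hQ0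
  have t3 : w * cnormSq c ≤ K⁻¹ * cnormSq c := by gcongr
  have t4 : w * cnormSq (leray L k (transportCoef L u v k)) ≤ w * (4 * (K * Q)) := by gcongr
  have t5 := mul_le_mul_of_nonneg_left t1 (sq_nonneg ν)
  have t6 := mul_le_mul_of_nonneg_left h3 hw0
  nlinarith

lemma comp_int {L : ℝ} {u : Pt → Vec} (h : IntegrableOn u (box L)) (i : Fin 3) :
    Integrable (fun x => u x i) (bm L) :=
  integrable_bm ((ContinuousLinearMap.proj (R := ℝ) (φ := fun _ : Fin 3 => ℝ) i).integrable_comp h)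

lemma main_pt {L ν : ℝ} (hL : 0 < L) {u v : Pt → Vec} (hu : ZeroMean L u)
    (hui : IntegrableOn u (box L)) (hvi : IntegrableOn v (box L))
    (hus : Summable fun k => cnormSq (fc L u k)) (hvs : Summable fun k => cnormSq (fc L v k))
    (hu1 : homSummable L 1 u) (c : Lat → Fin 3 → ℂ) (hc0 : c 0 = 0)
    (hcs : Summable fun k : Lat => freqNormSq L k ^ (-(1 : ℝ)) * cnormSq (c k)) :
    L ^ 3 * ∑' k : Lat, (1 + freqNormSq L k) ^ (-(3 : ℝ) / 2) *
            (cnormSq fun i =>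
              -(((ν * freqNormSq L k : ℝ) : ℂ) * fc L u k i)
                - leray L k (transportCoef L u v k) i
                + c k i)
    ≤ 3 * ν ^ 2 * homSobSq L 1 u
      + 148176 * (L / (2 * π)) ^ 3 * (∑' k, cnormSq (fc L v k)) * homSobSq L 1 u
      + 3 * hNegSobSq L c := by
  have hp := Real.pi_pos
  set S1 := ∑' k, freqNormSq L k ^ (1:ℝ) * cnormSq (fc L u k) with hS1
  set S0 := ∑' k, cnormSq (fc L v k) with hS0
  set Sf := ∑' k, freqNormSq L k ^ (-(1:ℝ)) * cnormSq (c k) with hSf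
  have nn1 : ∀ k, 0 ≤ freqNormSq L k ^ (1:ℝ) * cnormSq (fc L u k) := fun k =>
    mul_nonneg (Real.rpow_nonneg (freqNormSq_nonneg L k) _) (cnormSq_nonneg _)
  have nn2 : ∀ k, 0 ≤ freqNormSq L k ^ (-(1:ℝ)) * cnormSq (c k) := fun k =>
    mul_nonneg (Real.rpow_nonneg (freqNormSq_nonneg L k) _) (cnormSq_nonneg _)
  have hS10 : 0 ≤ S1 := tsum_nonneg nn1
  have hprod : ∀ i j, ∀ F : Finset Lat,
      ∑ k ∈ F, ‖k‖⁻¹ * ‖fcS L (fun x => u x i * v x j) k‖ ^ 2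
        ≤ 1372 * ((L / (2 * π)) ^ 2 * S1 * S0) := by
    intro i j F
    have hA : ∀ G : Finset Lat, ∑ m ∈ G, ‖m‖ ^ 2 * ‖fcS L (fun x => u x i) m‖ ^ 2
        ≤ (L / (2 * π)) ^ 2 * S1 := by
      intro G
      refine le_trans ?_ (mul_le_mul_of_nonneg_left (hu1.sum_le_tsum G fun k _ => nn1 k) (by positivity))
      rw [Finset.mul_sum]
      refine Finset.sum_le_sum fun m _ => ?_
      have h1 : ‖fcS L (fun x => u x i) m‖ ^ 2 ≤ cnormSq (fc L u m) := le_cnormSq (fc L u m) i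
      have h2 : ‖m‖ ^ 2 ≤ (L / (2 * π)) ^ 2 * freqNormSq L m := by
        have := pow_le_pow_left₀ (norm_nonneg m) (freq_lower hL m) 2
        rwa [mul_pow, Real.sq_sqrt (freqNormSq_nonneg L m)] at this
      rw [Real.rpow_one, ← mul_assoc]
      exact mul_le_mul h2 h1 (by positivity) ((by positivity : (0:ℝ) ≤ ‖m‖ ^ 2).trans h2)
    refine (prod_lim hL (comp_int hui i) (comp_int hvi j) (comp_summable hus i)
      (comp_summable hvs j) (hu i) hA F).trans ?_
    have : ∑' k, ‖fcS L (fun x => v x j) k‖ ^ 2 ≤ S0 :=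
      (comp_summable hvs j).tsum_le_tsum (fun k => le_cnormSq (fc L v k) j) hvs
    gcongr
  have hfin : ∀ F : Finset Lat, ∑ k ∈ F, (1 + freqNormSq L k) ^ (-(3 : ℝ) / 2) *
            (cnormSq fun i =>
              -(((ν * freqNormSq L k : ℝ) : ℂ) * fc L u k i)
                - leray L k (transportCoef L u v k) i
                + c k i) ≤ 3 * ν ^ 2 * S1 + 148176 * (L / (2 * π)) ^ 3 * S0 * S1 + 3 * Sf := by
    intro F
    refine (Finset.sum_le_sum fun k _ => term_bound hL u v hu (c k) k
      (fun h => by rw [h]; exact hc0)).trans ?_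
    rw [Finset.sum_add_distrib, Finset.sum_add_distrib, ← Finset.mul_sum, ← Finset.mul_sum,
      ← Finset.mul_sum]
    have e1 := hu1.sum_le_tsum F fun k _ => nn1 k
    have e2 := hcs.sum_le_tsum F fun k _ => nn2 k
    have e3 : ∑ k ∈ F, ∑ i, ∑ j, ‖k‖⁻¹ * ‖fcS L (fun x => u x i * v x j) k‖ ^ 2
        ≤ 9 * (1372 * ((L / (2 * π)) ^ 2 * S1 * S0)) := by
      rw [Finset.sum_comm]
      have : ∀ i : Fin 3, ∑ k ∈ F, ∑ j, ‖k‖⁻¹ * ‖fcS L (fun x => u x i * v x j) k‖ ^ 2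
          ≤ 3 * (1372 * ((L / (2 * π)) ^ 2 * S1 * S0)) := by
        intro i
        rw [Finset.sum_comm]
        refine (Finset.sum_le_sum fun j _ => hprod i j F).trans ?_
        simp
      refine (Finset.sum_le_sum fun i _ => this i).trans ?_
      simp; linarith
    have e4 := mul_le_mul_of_nonneg_left e3 (by positivity : 0 ≤ 12 * (L / (2 * π)))
    have e5 := mul_le_mul_of_nonneg_left e1 (by positivity : 0 ≤ 3 * ν ^ 2)
    have e6 : 12 * (L / (2 * π)) * (9 * (1372 * ((L / (2 * π)) ^ 2 * S1 * S0)))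
      = 148176 * (L / (2 * π)) ^ 3 * S0 * S1 := by ring
    linarith
  have hle := Real.tsum_le_of_sum_le (fun k => mul_nonneg
    (Real.rpow_nonneg (by linarith [freqNormSq_nonneg L k]) _) (cnormSq_nonneg _)) hfin
  have := mul_le_mul_of_nonneg_left hle (by positivity : 0 ≤ L ^ 3)
  refine this.trans (le_of_eq ?_)
  rw [homSobSq, hNegSobSq]
  ring

lemma homSobSq_nonneg {L : ℝ} (hL : 0 < L) (s : ℝ) (g : Pt → Vec) : 0 ≤ homSobSq L s g :=
  mul_nonneg (by positivity) (tsum_nonneg fun k =>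
    mul_nonneg (Real.rpow_nonneg (freqNormSq_nonneg L k) _) (cnormSq_nonneg _))

lemma hNeg_nonneg {L : ℝ} (hL : 0 < L) (c : Lat → Fin 3 → ℂ) : 0 ≤ hNegSobSq L c :=
  mul_nonneg (by positivity) (tsum_nonneg fun k =>
    mul_nonneg (Real.rpow_nonneg (freqNormSq_nonneg L k) _) (cnormSq_nonneg _))

lemma pairing_le {L ν : ℝ} (hL : 0 < L) (hν : 0 < ν) {u : Pt → Vec} (hu1 : homSummable L 1 u)
    (c : Lat → Fin 3 → ℂ) (hc0 : c 0 = 0)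
    (hcs : Summable fun k : Lat => freqNormSq L k ^ (-(1 : ℝ)) * cnormSq (c k)) :
    2 * pairing L c u ≤ ν⁻¹ * hNegSobSq L c + ν * homSobSq L 1 u := by
  have hterm : ∀ k, ‖∑ i, c k i * starRingEnd ℂ (fc L u k i)‖
      ≤ (2 * ν)⁻¹ * (freqNormSq L k ^ (-(1 : ℝ)) * cnormSq (c k))
        + ν / 2 * (freqNormSq L k ^ (1 : ℝ) * cnormSq (fc L u k)) := by
    intro k
    by_cases hk : k = 0
    · subst hk; simp [hc0, freqNormSq_zero]
    have hK := freqNormSq_pos hL hk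
    rw [Real.rpow_one, Real.rpow_neg_one, cnormSq_eq, cnormSq_eq]
    simp_rw [Finset.mul_sum]
    rw [← Finset.sum_add_distrib]
    refine (norm_sum_le _ _).trans (Finset.sum_le_sum fun i _ => ?_)
    rw [norm_mul, RCLike.norm_conj]
    set K := freqNormSq L k
    set x := ‖c k i‖
    set y := ‖fc L u k i‖
    have : (2 * ν)⁻¹ * (K⁻¹ * x ^ 2) + ν / 2 * (K * y ^ 2) - x * y
        = (2 * ν * K)⁻¹ * (x - ν * K * y) ^ 2 := by
      field_simp; ring
    have h2 : 0 ≤ (2 * ν * K)⁻¹ * (x - ν * K * y) ^ 2 := by positivity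
    linarith
  have hs := (hcs.mul_left (2 * ν)⁻¹).add (Summable.mul_left (ν / 2) hu1)
  have h1 := tsum_of_norm_bounded hs.hasSum hterm
  rw [(hcs.mul_left (2 * ν)⁻¹).tsum_add (Summable.mul_left (ν / 2) hu1), tsum_mul_left,
    tsum_mul_left] at h1
  have h2 := (Complex.re_le_norm _).trans h1
  have h3 := mul_le_mul_of_nonneg_left h2 (by positivity : 0 ≤ 2 * L ^ 3)
  rw [pairing, hNegSobSq, homSobSq]
  rw [← mul_assoc]
  refine h3.trans (le_of_eq ?_)
  field_simp

lemma energy_bound {L ν T : ℝ} (hL : 0 < L) (hν : 0 < ν) (hT : 0 < T) {u₀ : Pt → Vec}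
    {f : ForceData L} {u : ℝ → Pt → Vec}
    (hae : ∀ᵐ t ∂(volume.restrict (Set.Icc (0 : ℝ) T)), homSummable L 1 (u t))
    (hint : IntegrableOn (fun t => homSobSq L 1 (u t)) (Set.Icc (0 : ℝ) T))
    (hE : EnergyIneq L ν f.coef u u₀) {t : ℝ} (ht : t ∈ Set.Icc (0:ℝ) T) :
    homSobSq L 0 (u t) + ν * ∫ s in Set.Ioc (0 : ℝ) t, homSobSq L 1 (u s)
      ≤ homSobSq L 0 u₀ + ν⁻¹ * ∫ s in Set.Ioc (0:ℝ) T, hNegSobSq L (f.coef s) := by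
  have h := hE t ht.1
  have hsub : Set.Ioc (0:ℝ) t ⊆ Set.Icc 0 T := fun x hx => ⟨hx.1.le, hx.2.trans ht.2⟩
  have hsub2 : Set.Ioc (0:ℝ) t ⊆ Set.Ioc 0 T := Set.Ioc_subset_Ioc_right ht.2
  have hi1 : IntegrableOn (fun s => homSobSq L 1 (u s)) (Set.Ioc 0 t) := hint.mono_set hsub
  have hi2 : IntegrableOn (fun s => hNegSobSq L (f.coef s)) (Set.Ioc 0 T) :=
    (f.locL2 T hT).mono_set Set.Ioc_subset_Icc_self
  have hi3 : IntegrableOn (fun s => hNegSobSq L (f.coef s)) (Set.Ioc 0 t) := hi2.mono_set hsub2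
  have hmono : ∫ s in Set.Ioc (0:ℝ) t, hNegSobSq L (f.coef s)
      ≤ ∫ s in Set.Ioc (0:ℝ) T, hNegSobSq L (f.coef s) :=
    setIntegral_mono_set hi2 (Eventually.of_forall fun s => hNeg_nonneg hL _)
      (HasSubset.Subset.eventuallyLE hsub2)
  have hn0 : 0 ≤ ∫ s in Set.Ioc (0:ℝ) t, hNegSobSq L (f.coef s) :=
    integral_nonneg fun s => hNeg_nonneg hL _
  have hh0 : 0 ≤ ∫ s in Set.Ioc (0:ℝ) t, homSobSq L 1 (u s) :=
    integral_nonneg fun s => homSobSq_nonneg hL _ _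
  have hp : 2 * ∫ s in Set.Ioc (0 : ℝ) t, pairing L (f.coef s) (u s)
      ≤ ν⁻¹ * (∫ s in Set.Ioc (0:ℝ) t, hNegSobSq L (f.coef s))
        + ν * ∫ s in Set.Ioc (0:ℝ) t, homSobSq L 1 (u s) := by
    by_cases hpi : IntegrableOn (fun s => pairing L (f.coef s) (u s)) (Set.Ioc 0 t)
    · rw [← integral_const_mul, ← integral_const_mul, ← integral_const_mul,
        ← integral_add (hi3.const_mul _) (hi1.const_mul _)]
      refine integral_mono_ae (hpi.const_mul _) ((hi3.const_mul _).add (hi1.const_mul _)) ?_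
      filter_upwards [ae_restrict_of_ae_restrict_of_subset hsub hae] with s hs
      exact pairing_le hL hν hs _ (funext (f.zeroMean s)) (f.hsummable s)
    · rw [integral_undef hpi]
      have : 0 < ν⁻¹ := by positivity
      have := mul_nonneg this.le hn0
      have := mul_nonneg hν.le hh0
      linarith
  have h5 := mul_le_mul_of_nonneg_left hmono (by positivity : 0 ≤ ν⁻¹)
  linarith

/-- Lemma 5.1: uniform (in `α`) bounds for the family of weak Leray
solutions: bound in `E_T`, bound on `∂ₜu_{(α)} = νΔu_{(α)} − ℙ((u_{(α),α}·∇)u_{(α)}) + f`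
in `L²([0,T],H^{-3/2})`, and bound on the filtered velocities in `L^∞([0,T],L²)`. -/
theorem uniform_bounds_in_alpha
    (L ν β T : ℝ) (hL : 0 < L) (hν : 0 < ν) (hβ0 : 0 < β) (hβ1 : β < 1) (hT : 0 < T)
    (A : Vec → ℝ) (hAbdd : IndicatorBounds β A) (hAlip : IndicatorC01 A)
    (φ : Pt → ℝ) (hφ : KernelL2 L φ)
    (u₀ : Pt → Vec) (hu₀ : MemL2s L u₀) (f : ForceData L)
    (U Ua : ℝ → ℝ → Pt → Vec) (Pp : ℝ → ℝ → Pt → ℝ)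
    (hSol : ∀ α : ℝ, 0 < α → IsLeraySol L ν α A φ u₀ f (U α) (Ua α) (Pp α)) :
    ∃ M₁ : ℝ, 0 < M₁ ∧
      -- (1) `sup_{α>0} ‖u_{(α)}‖_{E_T} ≤ M₁`
      (∀ α : ℝ, 0 < α → eTNorm L ν T (U α) ≤ M₁) ∧
      -- (2) `sup_{α>0} ‖∂ₜu_{(α)}‖_{L²([0,T],H^{-3/2})} ≤ M₁`
      (∀ α : ℝ, 0 < α →
        Real.sqrt (∫ t in Set.Ioc (0 : ℝ) T,
          L ^ 3 * ∑' k : Lat, (1 + freqNormSq L k) ^ (-(3 : ℝ) / 2) *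
            cnormSq fun i =>
              -(((ν * freqNormSq L k : ℝ) : ℂ) * fc L (U α t) k i)
                - leray L k (transportCoef L (U α t) (Ua α t) k) i
                + f.coef t k i) ≤ M₁) ∧
      -- moreover `sup_{α>0} ‖u_{(α),α}‖_{L^∞([0,T],L²)} ≤ M₁`
      (∀ α : ℝ, 0 < α → ∀ t ∈ Set.Icc (0 : ℝ) T,
        Real.sqrt (homSobSq L 0 (Ua α t)) ≤ M₁) := by
  have hp := Real.pi_pos
  set N := ∫ s in Set.Ioc (0:ℝ) T, hNegSobSq L (f.coef s) with hN
  set E0 := homSobSq L 0 u₀ + ν⁻¹ * N with hE0d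
  have hN0 : 0 ≤ N := integral_nonneg fun s => hNeg_nonneg hL _
  have hE00 : 0 ≤ E0 := by
    have := homSobSq_nonneg hL 0 u₀
    positivity
  have hT' : T ∈ Set.Icc (0:ℝ) T := ⟨hT.le, le_rfl⟩
  have en : ∀ α : ℝ, 0 < α → ∀ t ∈ Set.Icc (0:ℝ) T,
      homSobSq L 0 (U α t) + ν * ∫ s in Set.Ioc (0 : ℝ) t, homSobSq L 1 (U α s) ≤ E0 := by
    intro α hα t ht
    have S := hSol α hα
    exact energy_bound hL hν hT (S.uH1ae T hT) (S.uH1int T hT) S.energy ht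
  have hI0 : ∀ α t : ℝ, 0 ≤ ∫ s in Set.Ioc (0 : ℝ) t, homSobSq L 1 (U α s) := fun α t =>
    integral_nonneg fun s => homSobSq_nonneg hL _ _
  have en0 : ∀ α : ℝ, 0 < α → ∀ t ∈ Set.Icc (0:ℝ) T, homSobSq L 0 (U α t) ≤ E0 := by
    intro α hα t ht
    have := en α hα t ht
    have := mul_nonneg hν.le (hI0 α t)
    linarith
  have en1 : ∀ α : ℝ, 0 < α → ν * ∫ s in Set.Ioc (0 : ℝ) T, homSobSq L 1 (U α s) ≤ E0 := by
    intro α hα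
    have := en α hα T hT'
    have := homSobSq_nonneg hL 0 (U α T)
    linarith
  have fb : ∀ α : ℝ, 0 < α → ∀ t ∈ Set.Icc (0:ℝ) T,
      ∑' k, cnormSq (fc L (Ua α t) k) ≤ ∑' k, cnormSq (fc L (U α t) k) := by
    intro α hα t ht
    have S := hSol α hα
    exact filter_bound hL (B := fun x => A (pconv L φ (U α t) x))
      (fun x => hβ0.le.trans (hAbdd _).1) (fun x => (hAbdd _).2)
      (S.uaMem t ht.1).1.2.2.2 (homSummable_zero (S.uMem t ht.1).2.2.2.2) (S.filter t ht.1)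
  have ea0 : ∀ α : ℝ, 0 < α → ∀ t ∈ Set.Icc (0:ℝ) T, homSobSq L 0 (Ua α t) ≤ E0 := by
    intro α hα t ht
    refine le_trans ?_ (en0 α hα t ht)
    rw [homSobSq_zero, homSobSq_zero]
    have := fb α hα t ht
    gcongr
  set C := 3 * ν ^ 2 + 148176 * (L / (2 * π)) ^ 3 * (E0 / L ^ 3) with hC
  have hC0 : 0 ≤ C := by positivity
  set D := C * (E0 / ν) + 3 * N with hD
  refine ⟨2 * √E0 + √D + 1, by positivity, ?_, ?_, ?_⟩
  · intro α hα
    have : Nonempty (Set.Icc (0:ℝ) T) := ⟨⟨T, hT'⟩⟩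
    have h1 : supNormL2 L T (U α) ≤ √E0 :=
      ciSup_le fun t => Real.sqrt_le_sqrt (en0 α hα t t.2)
    have h2 := Real.sqrt_le_sqrt (en1 α hα)
    have := Real.sqrt_nonneg D
    rw [eTNorm]
    linarith
  · intro α hα
    have S := hSol α hα
    have hi1 : IntegrableOn (fun s => homSobSq L 1 (U α s)) (Set.Ioc 0 T) :=
      (S.uH1int T hT).mono_set Set.Ioc_subset_Icc_self
    have hi2 : IntegrableOn (fun s => hNegSobSq L (f.coef s)) (Set.Ioc 0 T) :=
      (f.locL2 T hT).mono_set Set.Ioc_subset_Icc_self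
    refine le_trans (b := √D) (Real.sqrt_le_sqrt ?_) (by linarith [Real.sqrt_nonneg E0])
    have hb : ∫ t in Set.Ioc (0:ℝ) T, (C * homSobSq L 1 (U α t) + 3 * hNegSobSq L (f.coef t)) ≤ D := by
      rw [integral_add (hi1.const_mul _) (hi2.const_mul _), integral_const_mul, integral_const_mul]
      have : ∫ s in Set.Ioc (0 : ℝ) T, homSobSq L 1 (U α s) ≤ E0 / ν := by
        rw [le_div_iff₀ hν, mul_comm]; exact en1 α hα
      have := mul_le_mul_of_nonneg_left this hC0
      linarith
    refine le_trans (integral_mono_of_nonneg ?_ ((hi1.const_mul _).add (hi2.const_mul _)) ?_) hb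
    · refine Eventually.of_forall fun t => ?_
      exact mul_nonneg (by positivity) (tsum_nonneg fun k => mul_nonneg
        (Real.rpow_nonneg (by linarith [freqNormSq_nonneg L k]) _) (cnormSq_nonneg _))
    · filter_upwards [ae_restrict_of_ae_restrict_of_subset Set.Ioc_subset_Icc_self (S.uH1ae T hT),
        ae_restrict_mem measurableSet_Ioc] with t ht1 ht
      have ht' : t ∈ Set.Icc (0:ℝ) T := ⟨ht.1.le, ht.2⟩
      obtain ⟨-, ui, uz, -, us⟩ := S.uMem t ht'.1
      obtain ⟨⟨-, vi, -, vs⟩, -⟩ := S.uaMem t ht'.1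
      refine (main_pt (ν := ν) hL uz ui vi (homSummable_zero us) (sob_summable_zero vs) ht1
        (f.coef t) (funext (f.zeroMean t)) (f.hsummable t)).trans ?_
      have h0 : ∑' k, cnormSq (fc L (Ua α t) k) ≤ E0 / L ^ 3 := by
        have := ea0 α hα t ht'
        rw [homSobSq_zero] at this
        rw [le_div_iff₀ (by positivity), mul_comm]
        exact this
      have h1 := homSobSq_nonneg hL 1 (U α t)
      have h2 : 148176 * (L / (2 * π)) ^ 3 * (∑' k, cnormSq (fc L (Ua α t) k)) * homSobSq L 1 (U α t)
        ≤ 148176 * (L / (2 * π)) ^ 3 * (E0 / L ^ 3) * homSobSq L 1 (U α t) := by gcongr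
      simp only [Pi.add_apply]
      rw [hC]
      linarith
  · intro α hα t ht
    have := Real.sqrt_le_sqrt (ea0 α hα t ht)
    linarith [Real.sqrt_nonneg E0, Real.sqrt_nonneg D]

end NSAlpha
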